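/- arXiv:1901.08307 — 12 statements merged into one kernel-verified Lean document; each statement's English description precedes it below -/
import Mathlib

section
/- Fix ε > 0 and δ ≥ 1. Let v₁, v₂ : ℝ → ℝ be bounded, twice continuously differentiable solutions of the system −v₁'' + (1/ε²) v₁ (v₁² + v₂² − 1) + ((δ−1)/ε²) v₂² v₁ = 0 and −v₂'' + (1/ε²) v₂ (v₁² + v₂² − 1) + ((δ−1)/ε²) v₁² v₂ = 0 on ℝ, such that v₁(t)² + v₂(t)² → 1 as t → +∞ and as t → −∞. Then v₁(t)² + v₂(t)² ≤ 1 for every t ∈ ℝ. -/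
open MeasureTheory Filter

/-- The one-dimensional two-component Gross–Pitaevskii system: `v` satisfies
`-v'' + (1/ε²) v (v₁² + v₂² - 1) + ((δ-1)/ε²) w² v = 0`, where `w` is the other component. -/
def ODE1D (ε δ : ℝ) (v₁ v₂ v w : ℝ → ℝ) : Prop :=
  ∀ t : ℝ,
    -(deriv (deriv v) t) + (1 / ε ^ 2) * v t * (v₁ t ^ 2 + v₂ t ^ 2 - 1)
      + ((δ - 1) / ε ^ 2) * (w t) ^ 2 * v t = 0

/-- **Maximum principle on the line.** A continuous function with limit `c` at `±∞` which is
strictly convex, in the sense of a positive second derivative, wherever it exceeds `c`, is bounded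
above by `c`. -/
theorem le_of_tendsto_of_deriv_deriv_pos {u : ℝ → ℝ} {c : ℝ} (hu : Continuous u)
    (htop : Tendsto u atTop (nhds c)) (hbot : Tendsto u atBot (nhds c))
    (hpos : ∀ t, c < u t → 0 < deriv (deriv u) t) (t : ℝ) : u t ≤ c := by
  by_contra! ht
  have hev : ∀ᶠ x in cocompact ℝ, u x ≤ u t := by
    rw [cocompact_eq_atBot_atTop, eventually_sup]
    exact ⟨hbot.eventually_le_const ht, htop.eventually_le_const ht⟩
  obtain ⟨s, hs⟩ := hu.exists_forall_ge' t hev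
  have hmax : IsLocalMax u s := Eventually.of_forall hs
  have hs_pos := hpos s (ht.trans_le (hs t))
  have hmin := isLocalMin_of_deriv_deriv_pos hs_pos hmax.deriv_eq_zero hu.continuousAt
  have hconst : u =ᶠ[nhds s] fun _ => u s :=
    (hmax.and hmin).mono fun x hx => le_antisymm hx.1 hx.2
  have hzero : deriv (deriv u) s = 0 := by simpa using hconst.deriv.deriv_eq
  exact hs_pos.ne' hzero

theorem hasDerivAt_deriv_sq {v : ℝ → ℝ} (hv : ContDiff ℝ 2 v) (t : ℝ) :
    HasDerivAt (deriv fun s => v s ^ 2) (2 * deriv v t ^ 2 + 2 * (v t * deriv (deriv v) t)) t := by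
  have hd : Differentiable ℝ v := hv.differentiable (by norm_num)
  have hdd : Differentiable ℝ (deriv v) := hv.differentiable_deriv_two
  have hderiv : (deriv fun s => v s ^ 2) = fun s => 2 * (v s * deriv v s) := by
    funext s
    rw [((hd s).hasDerivAt.fun_pow 2).deriv]
    ring
  rw [hderiv]
  exact (((hd t).hasDerivAt.fun_mul (hdd t).hasDerivAt).const_mul 2).congr_deriv (by ring)

/-- Bounded entire solutions of the 1D two-component system whose total density tends to `1`
at `±∞` satisfy `v₁² + v₂² ≤ 1` everywhere. -/
theorem total_density_le_one_1D (ε δ : ℝ) (hε : 0 < ε) (hδ : 1 ≤ δ)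
    (v₁ v₂ : ℝ → ℝ) (h₁ : ContDiff ℝ 2 v₁) (h₂ : ContDiff ℝ 2 v₂)
    (hb₁ : ∃ M, ∀ t, |v₁ t| ≤ M) (hb₂ : ∃ M, ∀ t, |v₂ t| ≤ M)
    (hode₁ : ODE1D ε δ v₁ v₂ v₁ v₂) (hode₂ : ODE1D ε δ v₁ v₂ v₂ v₁)
    (hlim_top : Tendsto (fun t => v₁ t ^ 2 + v₂ t ^ 2) atTop (nhds 1))
    (hlim_bot : Tendsto (fun t => v₁ t ^ 2 + v₂ t ^ 2) atBot (nhds 1)) :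
    ∀ t : ℝ, v₁ t ^ 2 + v₂ t ^ 2 ≤ 1 := by
  refine le_of_tendsto_of_deriv_deriv_pos ((h₁.continuous.pow 2).add (h₂.continuous.pow 2))
    hlim_top hlim_bot fun t ht => ?_
  have hderiv : (deriv fun s => v₁ s ^ 2 + v₂ s ^ 2) =
      fun s => deriv (fun r => v₁ r ^ 2) s + deriv (fun r => v₂ r ^ 2) s := by
    funext s
    exact deriv_fun_add ((h₁.pow 2).differentiable (by norm_num) s)
      ((h₂.pow 2).differentiable (by norm_num) s)
  rw [hderiv, ((hasDerivAt_deriv_sq h₁ t).fun_add (hasDerivAt_deriv_sq h₂ t)).deriv]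
  have hkey : v₁ t * deriv (deriv v₁) t + v₂ t * deriv (deriv v₂) t =
      (1 / ε ^ 2) * ((v₁ t ^ 2 + v₂ t ^ 2) * (v₁ t ^ 2 + v₂ t ^ 2 - 1)
        + 2 * (δ - 1) * (v₁ t * v₂ t) ^ 2) := by
    linear_combination -v₁ t * hode₁ t - v₂ t * hode₂ t
  have hreaction : 0 < v₁ t * deriv (deriv v₁) t + v₂ t * deriv (deriv v₂) t := by
    rw [hkey]
    have hprod : 0 < (v₁ t ^ 2 + v₂ t ^ 2) * (v₁ t ^ 2 + v₂ t ^ 2 - 1) :=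
      mul_pos (one_pos.trans ht) (sub_pos.2 ht)
    have hcoupling : 0 ≤ δ - 1 := sub_nonneg.2 hδ
    positivity
  linarith [sq_nonneg (deriv v₁ t), sq_nonneg (deriv v₂ t)]
end

section
/- Fix ε > 0 and δ ≥ 1. Let v₁, v₂ : ℝ → ℝ be bounded, twice continuously differentiable solutions on ℝ of −v_j'' + (1/ε²) v_j (v₁² + v₂² − 1) + ((δ−1)/ε²) v_{3−j}² v_j = 0 (j = 1,2). Assume v₁'(t), v₂'(t) → 0 as t → ±∞, that v₁'², v₂'², (1 − v₁² − v₂²)² and v₁²v₂² are integrable on ℝ, and that t·( v₁'(t)² + v₂'(t)² + (1/(4ε²))(1 − v₁(t)² − v₂(t)²)² + ((δ−1)/(2ε²)) v₁(t)² v₂(t)² ) → 0 as |t| → ∞. Then ∫_ℝ ½( v₁'(t)² + v₂'(t)² ) dt = ∫_ℝ [ (1/(4ε²))(1 − v₁(t)² − v₂(t)²)² + ((δ−1)/(2ε²)) v₁(t)² v₂(t)² ] dt. -/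
open MeasureTheory Filter

/-- Conservation of the Hamiltonian along solutions of the 1D system. -/
lemma hasDerivAt_hamiltonian_ODE1D {ε δ : ℝ} {v₁ v₂ : ℝ → ℝ}
    (h₁ : ContDiff ℝ 2 v₁) (h₂ : ContDiff ℝ 2 v₂)
    (hode₁ : ODE1D ε δ v₁ v₂ v₁ v₂) (hode₂ : ODE1D ε δ v₁ v₂ v₂ v₁) (t : ℝ) :
    HasDerivAt (fun t => (1 / 2) * ((deriv v₁ t) ^ 2 + (deriv v₂ t) ^ 2)
      - ((1 / (4 * ε ^ 2)) * (1 - v₁ t ^ 2 - v₂ t ^ 2) ^ 2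
          + ((δ - 1) / (2 * ε ^ 2)) * (v₁ t ^ 2 * v₂ t ^ 2))) 0 t := by
  have d {v : ℝ → ℝ} (h : ContDiff ℝ 2 v) : HasDerivAt v (deriv v t) t :=
    (h.differentiable (by norm_num) t).hasDerivAt
  have dd {v : ℝ → ℝ} (h : ContDiff ℝ 2 v) : HasDerivAt (deriv v) (deriv (deriv v) t) t :=
    (((contDiff_succ_iff_deriv (n := 1)).1 h).2.2.differentiable (by norm_num) t).hasDerivAt
  have key := ((((dd h₁).pow 2).add ((dd h₂).pow 2)).const_mul (1 / 2)).sub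
    ((((((d h₁).pow 2).const_sub 1).sub ((d h₂).pow 2)).pow 2 |>.const_mul (1 / (4 * ε ^ 2))).add
      ((((d h₁).pow 2).mul ((d h₂).pow 2)).const_mul ((δ - 1) / (2 * ε ^ 2))))
  refine key.congr_deriv ?_
  have e₁ := hode₁ t
  have e₂ := hode₂ t
  simp only [Pi.pow_apply, Pi.sub_apply, Nat.cast_ofNat]
  linear_combination -(deriv v₁ t) * e₁ - (deriv v₂ t) * e₂

/-- Pohozaev identity: equipartition of energy for entire solutions of the 1D system. -/
theorem pohozaev_equipartition_1D (ε δ : ℝ) (hε : 0 < ε) (hδ : 1 ≤ δ)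
    (v₁ v₂ : ℝ → ℝ) (h₁ : ContDiff ℝ 2 v₁) (h₂ : ContDiff ℝ 2 v₂)
    (hb₁ : ∃ M, ∀ t, |v₁ t| ≤ M) (hb₂ : ∃ M, ∀ t, |v₂ t| ≤ M)
    (hode₁ : ODE1D ε δ v₁ v₂ v₁ v₂) (hode₂ : ODE1D ε δ v₁ v₂ v₂ v₁)
    (hd₁_top : Tendsto (deriv v₁) atTop (nhds 0)) (hd₁_bot : Tendsto (deriv v₁) atBot (nhds 0))
    (hd₂_top : Tendsto (deriv v₂) atTop (nhds 0)) (hd₂_bot : Tendsto (deriv v₂) atBot (nhds 0))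
    (hi₁ : Integrable (fun t => (deriv v₁ t) ^ 2))
    (hi₂ : Integrable (fun t => (deriv v₂ t) ^ 2))
    (hi₃ : Integrable (fun t => (1 - v₁ t ^ 2 - v₂ t ^ 2) ^ 2))
    (hi₄ : Integrable (fun t => v₁ t ^ 2 * v₂ t ^ 2))
    (hdecay : Tendsto (fun t : ℝ =>
        t * ((deriv v₁ t) ^ 2 + (deriv v₂ t) ^ 2
          + (1 / (4 * ε ^ 2)) * (1 - v₁ t ^ 2 - v₂ t ^ 2) ^ 2
          + ((δ - 1) / (2 * ε ^ 2)) * (v₁ t ^ 2 * v₂ t ^ 2)))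
      (atTop ⊔ atBot) (nhds 0)) :
    ∫ t : ℝ, (1 / 2) * ((deriv v₁ t) ^ 2 + (deriv v₂ t) ^ 2)
      = ∫ t : ℝ, ((1 / (4 * ε ^ 2)) * (1 - v₁ t ^ 2 - v₂ t ^ 2) ^ 2
          + ((δ - 1) / (2 * ε ^ 2)) * (v₁ t ^ 2 * v₂ t ^ 2)) := by
  have hK : Integrable (fun t => (1 / 2) * ((deriv v₁ t) ^ 2 + (deriv v₂ t) ^ 2)) :=
    (hi₁.add hi₂).const_mul _
  have hW : Integrable (fun t => (1 / (4 * ε ^ 2)) * (1 - v₁ t ^ 2 - v₂ t ^ 2) ^ 2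
      + ((δ - 1) / (2 * ε ^ 2)) * (v₁ t ^ 2 * v₂ t ^ 2)) :=
    (hi₃.const_mul _).add (hi₄.const_mul _)
  have hder := hasDerivAt_hamiltonian_ODE1D h₁ h₂ hode₁ hode₂
  have hconst := fun s t => is_const_of_deriv_eq_zero
    (fun x => (hder x).differentiableAt) (fun x => (hder x).deriv) s t
  rw [← sub_eq_zero, ← integral_sub hK hW]
  simp_rw [fun t => hconst t 0, integral_const]
  simp [measureReal_def]
end

section
/- Fix ε > 0 and δ ≥ 1. Let v₁, v₂ : ℝ → ℝ be bounded, twice continuously differentiable solutions on ℝ of −v_j'' + (1/ε²) v_j (v₁² + v₂² − 1) + ((δ−1)/ε²) v_{3−j}² v_j = 0 (j = 1,2). Assume v₁'(t), v₂'(t) → 0 as t → ±∞, and that v₁'², v₂'², (1 − v₁² − v₂²) and v₁²v₂² are integrable on ℝ. Then ∫_ℝ [ ¼( v₁'(t)² + v₂'(t)² ) + (1/(4ε²))(v₁(t)² + v₂(t)² − 1)(v₁(t)² + v₂(t)²) + ((δ−1)/(2ε²)) v₁(t)² v₂(t)² ] dt = 0. -/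
open MeasureTheory Filter

/-- Identity obtained by multiplying the 1D system by `(v₁, v₂)` and integrating. -/
theorem multiplier_identity_1D (ε δ : ℝ) (hε : 0 < ε) (hδ : 1 ≤ δ)
    (v₁ v₂ : ℝ → ℝ) (h₁ : ContDiff ℝ 2 v₁) (h₂ : ContDiff ℝ 2 v₂)
    (hb₁ : ∃ M, ∀ t, |v₁ t| ≤ M) (hb₂ : ∃ M, ∀ t, |v₂ t| ≤ M)
    (hode₁ : ODE1D ε δ v₁ v₂ v₁ v₂) (hode₂ : ODE1D ε δ v₁ v₂ v₂ v₁)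
    (hd₁_top : Tendsto (deriv v₁) atTop (nhds 0)) (hd₁_bot : Tendsto (deriv v₁) atBot (nhds 0))
    (hd₂_top : Tendsto (deriv v₂) atTop (nhds 0)) (hd₂_bot : Tendsto (deriv v₂) atBot (nhds 0))
    (hi₁ : Integrable (fun t => (deriv v₁ t) ^ 2))
    (hi₂ : Integrable (fun t => (deriv v₂ t) ^ 2))
    (hi₃ : Integrable (fun t => 1 - v₁ t ^ 2 - v₂ t ^ 2))
    (hi₄ : Integrable (fun t => v₁ t ^ 2 * v₂ t ^ 2)) :
    ∫ t : ℝ, ((1 / 4) * ((deriv v₁ t) ^ 2 + (deriv v₂ t) ^ 2)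
        + (1 / (4 * ε ^ 2)) * (v₁ t ^ 2 + v₂ t ^ 2 - 1) * (v₁ t ^ 2 + v₂ t ^ 2)
        + ((δ - 1) / (2 * ε ^ 2)) * (v₁ t ^ 2 * v₂ t ^ 2)) = 0 := by
  obtain ⟨M₁, hM₁⟩ := hb₁
  obtain ⟨M₂, hM₂⟩ := hb₂
  have key (t : ℝ) : HasDerivAt (fun t => 1 / 4 * (v₁ t * deriv v₁ t + v₂ t * deriv v₂ t))
      ((1 / 4) * ((deriv v₁ t) ^ 2 + (deriv v₂ t) ^ 2)
        + (1 / (4 * ε ^ 2)) * (v₁ t ^ 2 + v₂ t ^ 2 - 1) * (v₁ t ^ 2 + v₂ t ^ 2)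
        + ((δ - 1) / (2 * ε ^ 2)) * (v₁ t ^ 2 * v₂ t ^ 2)) t := by
    have d₁ := (h₁.differentiable two_ne_zero t).hasDerivAt
    have d₂ := (h₂.differentiable two_ne_zero t).hasDerivAt
    have e₁ := (h₁.differentiable_deriv_two t).hasDerivAt
    have e₂ := (h₂.differentiable_deriv_two t).hasDerivAt
    refine (((d₁.mul e₁).add (d₂.mul e₂)).const_mul (1 / 4)).congr_deriv ?_
    have o₁ := hode₁ t
    have o₂ := hode₂ t
    linear_combination (-(1 / 4) * v₁ t) * o₁ - (1 / 4) * v₂ t * o₂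
  have lim (l : Filter ℝ) (hl₁ : Tendsto (deriv v₁) l (nhds 0))
      (hl₂ : Tendsto (deriv v₂) l (nhds 0)) :
      Tendsto (fun t => 1 / 4 * (v₁ t * deriv v₁ t + v₂ t * deriv v₂ t)) l (nhds 0) := by
    convert ((bdd_le_mul_tendsto_zero' M₁ (.of_forall hM₁) hl₁).add
      (bdd_le_mul_tendsto_zero' M₂ (.of_forall hM₂) hl₂)).const_mul (1 / 4) using 2
    simp
  have hS : Integrable (fun t => (v₁ t ^ 2 + v₂ t ^ 2) * (1 - v₁ t ^ 2 - v₂ t ^ 2)) := by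
    refine hi₃.bdd_mul (c := M₁ ^ 2 + M₂ ^ 2)
      ((h₁.continuous.pow 2).add (h₂.continuous.pow 2)).aestronglyMeasurable
      (.of_forall fun t => ?_)
    rw [Real.norm_of_nonneg (by positivity)]
    exact add_le_add (sq_le_sq' (abs_le.mp (hM₁ t)).1 (abs_le.mp (hM₁ t)).2)
      (sq_le_sq' (abs_le.mp (hM₂ t)).1 (abs_le.mp (hM₂ t)).2)
  have hint : Integrable (fun t => (1 / 4) * ((deriv v₁ t) ^ 2 + (deriv v₂ t) ^ 2)
        + (1 / (4 * ε ^ 2)) * (v₁ t ^ 2 + v₂ t ^ 2 - 1) * (v₁ t ^ 2 + v₂ t ^ 2)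
        + ((δ - 1) / (2 * ε ^ 2)) * (v₁ t ^ 2 * v₂ t ^ 2)) := by
    refine ((((hi₁.add hi₂).const_mul (1 / 4)).add (hS.const_mul (-(1 / (4 * ε ^ 2))))).add
      (hi₄.const_mul ((δ - 1) / (2 * ε ^ 2)))).congr (.of_forall fun t => ?_)
    simp only [Pi.add_apply]
    ring
  simpa using integral_of_hasDerivAt_of_tendsto key hint (lim _ hd₁_bot hd₂_bot)
    (lim _ hd₁_top hd₂_top)
end

section
/- Fix ε > 0 and δ ≥ 1. Let v₁, v₂ : ℝ → ℝ be bounded, twice continuously differentiable solutions on ℝ of −v_j'' + (1/ε²) v_j (v₁² + v₂² − 1) + ((δ−1)/ε²) v_{3−j}² v_j = 0 (j = 1,2). Assume v₁'(t), v₂'(t) → 0 as t → ±∞, that v₁'², v₂'², (1 − v₁² − v₂²), (1 − v₁² − v₂²)² and v₁²v₂² are integrable on ℝ, and that t·( v₁'(t)² + v₂'(t)² + (1/(4ε²))(1 − v₁(t)² − v₂(t)²)² + ((δ−1)/(2ε²)) v₁(t)² v₂(t)² ) → 0 as |t| → ∞. Then ∫_ℝ (3/2)( v₁'(t)² + v₂'(t)²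 ) dt = (1/(2ε²)) ∫_ℝ (1 − v₁(t)² − v₂(t)²) dt. -/
open MeasureTheory Filter

/-- A bounded function times a function tending to zero tends to zero. -/
lemma tendsto_mul_zero_of_abs_le {l : Filter ℝ} {f g : ℝ → ℝ} (hf : ∃ M, ∀ t, |f t| ≤ M)
    (hg : Tendsto g l (nhds 0)) : Tendsto (fun t => f t * g t) l (nhds 0) := by
  obtain ⟨M, hM⟩ := hf
  simpa only [mul_comm] using hg.zero_mul_isBoundedUnder_le
    (isBoundedUnder_of ⟨M, hM⟩ : IsBoundedUnder (· ≤ ·) l (norm ∘ f))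

/-- If the energy density is `o(1 / t)` at `+∞`, then the kinetic density is twice the
potential density. -/
lemma ODE1D.equipartition {ε δ : ℝ} {v₁ v₂ : ℝ → ℝ}
    (h₁ : ContDiff ℝ 2 v₁) (h₂ : ContDiff ℝ 2 v₂)
    (hode₁ : ODE1D ε δ v₁ v₂ v₁ v₂) (hode₂ : ODE1D ε δ v₁ v₂ v₂ v₁)
    (hd₁ : Tendsto (deriv v₁) atTop (nhds 0)) (hd₂ : Tendsto (deriv v₂) atTop (nhds 0))
    (hdecay : Tendsto (fun t : ℝ =>
        t * ((deriv v₁ t) ^ 2 + (deriv v₂ t) ^ 2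
          + (1 / (4 * ε ^ 2)) * (1 - v₁ t ^ 2 - v₂ t ^ 2) ^ 2
          + ((δ - 1) / (2 * ε ^ 2)) * (v₁ t ^ 2 * v₂ t ^ 2)))
      atTop (nhds 0)) (t : ℝ) :
    (deriv v₁ t) ^ 2 + (deriv v₂ t) ^ 2
      = 2 * ((1 / (4 * ε ^ 2)) * (1 - v₁ t ^ 2 - v₂ t ^ 2) ^ 2
          + ((δ - 1) / (2 * ε ^ 2)) * (v₁ t ^ 2 * v₂ t ^ 2)) := by
  set E : ℝ → ℝ := fun t => (deriv v₁ t) ^ 2 + (deriv v₂ t) ^ 2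
      - 2 * ((1 / (4 * ε ^ 2)) * (1 - v₁ t ^ 2 - v₂ t ^ 2) ^ 2
          + ((δ - 1) / (2 * ε ^ 2)) * (v₁ t ^ 2 * v₂ t ^ 2)) with hE
  have hderiv : ∀ t, HasDerivAt E 0 t := by
    intro t
    have e₁ := (h₁.differentiable (by norm_num) t).hasDerivAt
    have e₂ := (h₂.differentiable (by norm_num) t).hasDerivAt
    have f₁ := (h₁.differentiable_deriv_two t).hasDerivAt
    have f₂ := (h₂.differentiable_deriv_two t).hasDerivAt
    have key := ((f₁.pow 2).add (f₂.pow 2)).sub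
      ((((((e₁.pow 2).const_sub 1).sub (e₂.pow 2)).pow 2).const_mul (1 / (4 * ε ^ 2))).add
        (((e₁.pow 2).mul (e₂.pow 2)).const_mul ((δ - 1) / (2 * ε ^ 2))) |>.const_mul 2)
    refine key.congr_deriv ?_
    have o₁ := hode₁ t
    have o₂ := hode₂ t
    simp only [Pi.pow_apply, Pi.sub_apply]
    norm_num
    linear_combination (-2 * deriv v₁ t) * o₁ + (-2 * deriv v₂ t) * o₂
  have hconst : ∀ s, E s = E t := fun s =>
    is_const_of_deriv_eq_zero (fun x => (hderiv x).differentiableAt)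
      (fun x => (hderiv x).deriv) s t
  have hG := (tendsto_inv_atTop_zero (𝕜 := ℝ)).mul hdecay
  have hlim : Tendsto E atTop (nhds 0) := by
    have := (((hd₁.pow 2).add (hd₂.pow 2)).const_mul 3).sub (hG.const_mul 2)
    norm_num at this
    refine this.congr' ?_
    filter_upwards [eventually_gt_atTop 0] with s hs
    rw [inv_mul_cancel_left₀ hs.ne', hE]
    ring
  have hzero : E t = 0 :=
    tendsto_nhds_unique (tendsto_const_nhds.congr fun s => (hconst s).symm) hlim
  exact sub_eq_zero.mp hzero

/-- Combined identity: the kinetic energy equals `(1/(2ε²)) ∫ (1 - v₁² - v₂²)`. -/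
theorem kinetic_mass_defect_identity_1D (ε δ : ℝ) (hε : 0 < ε) (hδ : 1 ≤ δ)
    (v₁ v₂ : ℝ → ℝ) (h₁ : ContDiff ℝ 2 v₁) (h₂ : ContDiff ℝ 2 v₂)
    (hb₁ : ∃ M, ∀ t, |v₁ t| ≤ M) (hb₂ : ∃ M, ∀ t, |v₂ t| ≤ M)
    (hode₁ : ODE1D ε δ v₁ v₂ v₁ v₂) (hode₂ : ODE1D ε δ v₁ v₂ v₂ v₁)
    (hd₁_top : Tendsto (deriv v₁) atTop (nhds 0)) (hd₁_bot : Tendsto (deriv v₁) atBot (nhds 0))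
    (hd₂_top : Tendsto (deriv v₂) atTop (nhds 0)) (hd₂_bot : Tendsto (deriv v₂) atBot (nhds 0))
    (hi₁ : Integrable (fun t => (deriv v₁ t) ^ 2))
    (hi₂ : Integrable (fun t => (deriv v₂ t) ^ 2))
    (hi₃ : Integrable (fun t => 1 - v₁ t ^ 2 - v₂ t ^ 2))
    (hi₃' : Integrable (fun t => (1 - v₁ t ^ 2 - v₂ t ^ 2) ^ 2))
    (hi₄ : Integrable (fun t => v₁ t ^ 2 * v₂ t ^ 2))
    (hdecay : Tendsto (fun t : ℝ =>
        t * ((deriv v₁ t) ^ 2 + (deriv v₂ t) ^ 2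
          + (1 / (4 * ε ^ 2)) * (1 - v₁ t ^ 2 - v₂ t ^ 2) ^ 2
          + ((δ - 1) / (2 * ε ^ 2)) * (v₁ t ^ 2 * v₂ t ^ 2)))
      (atTop ⊔ atBot) (nhds 0)) :
    ∫ t : ℝ, (3 / 2) * ((deriv v₁ t) ^ 2 + (deriv v₂ t) ^ 2)
      = (1 / (2 * ε ^ 2)) * ∫ t : ℝ, (1 - v₁ t ^ 2 - v₂ t ^ 2) := by
  have hvir : ∀ t, HasDerivAt (fun t => v₁ t * deriv v₁ t + v₂ t * deriv v₂ t)
      (3 * ((deriv v₁ t) ^ 2 + (deriv v₂ t) ^ 2)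
        - 1 / ε ^ 2 * (1 - v₁ t ^ 2 - v₂ t ^ 2)) t := by
    intro t
    have e₁ := (h₁.differentiable (by norm_num) t).hasDerivAt
    have e₂ := (h₂.differentiable (by norm_num) t).hasDerivAt
    refine ((e₁.mul (h₁.differentiable_deriv_two t).hasDerivAt).add
      (e₂.mul (h₂.differentiable_deriv_two t).hasDerivAt)).congr_deriv ?_
    have o₁ := hode₁ t
    have o₂ := hode₂ t
    have heq := ODE1D.equipartition h₁ h₂ hode₁ hode₂ hd₁_top hd₂_top
      (hdecay.mono_left le_sup_left) t
    linear_combination (-v₁ t) * o₁ + (-v₂ t) * o₂ - 2 * heq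
  have hK : Integrable fun t => (deriv v₁ t) ^ 2 + (deriv v₂ t) ^ 2 := hi₁.add hi₂
  have hlim : ∀ l : Filter ℝ, Tendsto (deriv v₁) l (nhds 0) → Tendsto (deriv v₂) l (nhds 0) →
      Tendsto (fun t => v₁ t * deriv v₁ t + v₂ t * deriv v₂ t) l (nhds 0) := by
    intro l hl₁ hl₂
    simpa using (tendsto_mul_zero_of_abs_le hb₁ hl₁).add (tendsto_mul_zero_of_abs_le hb₂ hl₂)
  have hint := integral_of_hasDerivAt_of_tendsto hvir
    ((hK.const_mul 3).sub (hi₃.const_mul (1 / ε ^ 2)))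
    (hlim _ hd₁_bot hd₂_bot) (hlim _ hd₁_top hd₂_top)
  rw [integral_sub (hK.const_mul 3) (hi₃.const_mul _), integral_const_mul,
    integral_const_mul] at hint
  rw [integral_const_mul]
  linear_combination (1 / 2) * hint
end

section
/- Let n ≥ 1, let W : ℝⁿ → ℝ be continuously differentiable, let a ∈ ℝⁿ, and let γ : ℝ → ℝⁿ be twice continuously differentiable with γ''(t) = ∇W(γ(t)) for all t. If γ(t) → a and γ'(t) → 0 as t → −∞, then for every t ∈ ℝ one has ½‖γ'(t)‖² = W(γ(t)) − W(a). In particular, if W(a) = 0 then ‖γ'(t)‖ = √(2 W(γ(t))) for every t. -/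
open Filter

/-- The energy `½‖γ'‖² - W(γ)` of a solution of `γ'' = ∇W(γ)` has zero derivative. -/
theorem hasDerivAt_energy_zero {E : Type*} [NormedAddCommGroup E] [InnerProductSpace ℝ E]
    [CompleteSpace E] {W : E → ℝ} {γ : ℝ → E} {t : ℝ} (hW : DifferentiableAt ℝ W (γ t))
    (hγ : DifferentiableAt ℝ γ t) (hγ' : DifferentiableAt ℝ (deriv γ) t)
    (hode : deriv (deriv γ) t = gradient W (γ t)) :
    HasDerivAt (fun s => (1 / 2) * ‖deriv γ s‖ ^ 2 - W (γ s)) 0 t := by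
  have hkin := (hγ'.hasDerivAt.norm_sq).const_mul (1 / 2 : ℝ)
  have hpot := hW.hasGradientAt.hasFDerivAt.comp_hasDerivAt t hγ.hasDerivAt
  refine (hkin.sub hpot).congr_deriv ?_
  rw [InnerProductSpace.toDual_apply_apply, hode, real_inner_comm]
  ring

/-- Conservation of energy for heteroclinic trajectories of `γ'' = ∇W(γ)` emanating from `a`
at `-∞`: `½‖γ'‖² = W(γ) - W(a)` along the trajectory. -/
theorem energy_conservation_from_well
    (n : ℕ) (hn : 1 ≤ n) (W : EuclideanSpace ℝ (Fin n) → ℝ) (hW : ContDiff ℝ 1 W)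
    (a : EuclideanSpace ℝ (Fin n)) (γ : ℝ → EuclideanSpace ℝ (Fin n)) (hγ : ContDiff ℝ 2 γ)
    (hode : ∀ t : ℝ, deriv (deriv γ) t = gradient W (γ t))
    (hlim : Tendsto γ atBot (nhds a))
    (hlim' : Tendsto (deriv γ) atBot (nhds 0)) :
    (∀ t : ℝ, (1 / 2) * ‖deriv γ t‖ ^ 2 = W (γ t) - W a) ∧
    (W a = 0 → ∀ t : ℝ, ‖deriv γ t‖ = Real.sqrt (2 * W (γ t))) := by
  have hγ' : Differentiable ℝ (deriv γ) :=
    ((contDiff_succ_iff_deriv (n := 1)).1 hγ).2.2.differentiable one_ne_zero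
  have hderiv (t : ℝ) := hasDerivAt_energy_zero (hW.differentiable one_ne_zero (γ t))
    (hγ.differentiable two_ne_zero t) (hγ' t) (hode t)
  have hconst := is_const_of_deriv_eq_zero (fun t => (hderiv t).differentiableAt)
    (fun t => (hderiv t).deriv)
  have htendsto : Tendsto (fun s => (1 / 2) * ‖deriv γ s‖ ^ 2 - W (γ s)) atBot
      (nhds (-W a)) := by
    simpa using ((hlim'.norm.pow 2).const_mul (1 / 2 : ℝ)).sub
      ((hW.continuous.tendsto a).comp hlim)
  have henergy (t : ℝ) : (1 / 2) * ‖deriv γ t‖ ^ 2 = W (γ t) - W a := by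
    have := tendsto_nhds_unique
      (tendsto_const_nhds.congr fun s => hconst t s) htendsto
    linarith
  refine ⟨henergy, fun ha t => ?_⟩
  rw [← Real.sqrt_sq (norm_nonneg (deriv γ t))]
  congr 1
  linarith [henergy t]
end

section
/- Let n ≥ 1, let W : ℝⁿ → ℝ be continuous and nonnegative, and let a ∈ ℝⁿ. Define d(x, a) ∈ [0, ∞] as the infimum over all continuously differentiable γ : ℝ → ℝⁿ with γ(t) → a as t → −∞ and γ(0) = x of ∫_{−∞}^0 ( ½‖γ'(t)‖² + W(γ(t)) ) dt. Then for all x, y ∈ ℝⁿ, d(y, a) ≤ d(x, a) + ‖y − x‖ · ∫_0^1 √( 2 W( x + t(y − x) ) ) dt. -/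
open Filter MeasureTheory
open scoped ENNReal

/-- The geodesic action distance from the well `a` (at `-∞`) to the point `x` (at time `0`),
associated to the potential `W`: the infimum of `∫_{-∞}^0 ½‖γ'‖² + W(γ)` over `C¹` curves. -/
noncomputable def actionDist (n : ℕ) (W : EuclideanSpace ℝ (Fin n) → ℝ)
    (a x : EuclideanSpace ℝ (Fin n)) : ℝ≥0∞ :=
  ⨅ γ : {γ : ℝ → EuclideanSpace ℝ (Fin n) //
      ContDiff ℝ 1 γ ∧ Tendsto γ atBot (nhds a) ∧ γ 0 = x},
    ∫⁻ t in Set.Iic (0 : ℝ), ENNReal.ofReal ((1 / 2) * ‖deriv γ.1 t‖ ^ 2 + W (γ.1 t))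

/-- A `C¹` time change that rests at `0` for negative times, accelerates on `[0, 2δ]`,
and has unit speed afterwards. -/
noncomputable def softStart (δ t : ℝ) : ℝ :=
  ∫ s in (0 : ℝ)..t, max 0 (min 1 (s / (2 * δ)))

lemma hasDerivAt_softStart (δ t : ℝ) :
    HasDerivAt (softStart δ) (max 0 (min 1 (t / (2 * δ)))) t := by
  have hc : Continuous fun s : ℝ => max 0 (min 1 (s / (2 * δ))) := by fun_prop
  exact intervalIntegral.integral_hasDerivAt_right (hc.intervalIntegrable _ _)
    (hc.stronglyMeasurableAtFilter _ _) hc.continuousAt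

lemma contDiff_softStart (δ : ℝ) : ContDiff ℝ 1 (softStart δ) := by
  rw [contDiff_one_iff_deriv]
  refine ⟨fun t => (hasDerivAt_softStart δ t).differentiableAt, ?_⟩
  have : deriv (softStart δ) = fun t => max 0 (min 1 (t / (2 * δ))) :=
    funext fun t => (hasDerivAt_softStart δ t).deriv
  rw [this]
  fun_prop

lemma softStart_of_nonpos {δ t : ℝ} (hδ : 0 < δ) (ht : t ≤ 0) : softStart δ t = 0 := by
  have : Set.EqOn (fun s : ℝ => max 0 (min 1 (s / (2 * δ)))) (fun _ => 0) (Set.uIcc 0 t) := by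
    intro s hs
    rw [Set.uIcc_of_ge ht] at hs
    exact max_eq_left ((min_le_right _ _).trans (div_nonpos_of_nonpos_of_nonneg hs.2 (by linarith)))
  rw [softStart, intervalIntegral.integral_congr this]
  simp

lemma monotone_softStart (δ : ℝ) : Monotone (softStart δ) :=
  monotone_of_deriv_nonneg (fun t => (hasDerivAt_softStart δ t).differentiableAt) fun t => by
    rw [(hasDerivAt_softStart δ t).deriv]
    exact le_max_left _ _

lemma softStart_of_le {δ t : ℝ} (hδ : 0 < δ) (ht : 2 * δ ≤ t) : softStart δ t = t - δ := by
  have hc : Continuous fun s : ℝ => max 0 (min 1 (s / (2 * δ))) := by fun_prop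
  have h₁ : Set.EqOn (fun s : ℝ => max 0 (min 1 (s / (2 * δ)))) (fun s => s / (2 * δ))
      (Set.uIcc 0 (2 * δ)) := by
    intro s hs
    rw [Set.uIcc_of_le (by linarith)] at hs
    have h0 : 0 ≤ s / (2 * δ) := div_nonneg hs.1 (by linarith)
    have h1 : s / (2 * δ) ≤ 1 := (div_le_one (by linarith)).2 hs.2
    simp [h0, h1]
  have h₂ : Set.EqOn (fun s : ℝ => max 0 (min 1 (s / (2 * δ)))) (fun _ => 1)
      (Set.uIcc (2 * δ) t) := by
    intro s hs
    rw [Set.uIcc_of_le ht] at hs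
    have h1 : 1 ≤ s / (2 * δ) := (one_le_div (by linarith)).2 hs.1
    simp [h1]
  rw [softStart, ← intervalIntegral.integral_add_adjacent_intervals
    (hc.intervalIntegrable 0 (2 * δ)) (hc.intervalIntegrable (2 * δ) t),
    intervalIntegral.integral_congr h₁, intervalIntegral.integral_congr h₂,
    intervalIntegral.integral_div, integral_id, intervalIntegral.integral_const]
  simp only [smul_eq_mul, mul_one]
  field_simp
  ring

lemma softStart_mem_Icc {δ t : ℝ} (hδ : 0 < δ) (ht : t ∈ Set.Icc 0 (2 * δ)) :
    softStart δ t ∈ Set.Icc 0 δ := by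
  constructor
  · rw [← softStart_of_nonpos hδ le_rfl]
    exact monotone_softStart δ ht.1
  · have := monotone_softStart δ ht.2
    rw [softStart_of_le hδ le_rfl] at this
    linarith

lemma deriv_softStart_mem_Icc (δ t : ℝ) : deriv (softStart δ) t ∈ Set.Icc (0 : ℝ) 1 := by
  rw [(hasDerivAt_softStart δ t).deriv]
  exact ⟨le_max_left _ _, max_le zero_le_one (min_le_left _ _)⟩

lemma lintegral_comp_softStart_le {δ : ℝ} (hδ : 0 < δ) (f : ℝ → ℝ≥0∞) {C : ℝ≥0∞}
    (hf : ∀ t ∈ Set.Icc 0 δ, f t ≤ C) :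
    ∫⁻ t in Set.Ici 0, f (softStart δ t) ≤
      (∫⁻ t in Set.Ici 0, f t) + C * ENNReal.ofReal (2 * δ) := by
  have hsplit : Set.Ici (0 : ℝ) = Set.Ici (2 * δ) ∪ Set.Ico 0 (2 * δ) := by
    rw [Set.union_comm, Set.Ico_union_Ici_eq_Ici (by linarith)]
  rw [hsplit]
  refine (lintegral_union_le _ _ _).trans ?_
  rw [← hsplit]
  refine add_le_add ?_ ?_
  · calc ∫⁻ t in Set.Ici (2 * δ), f (softStart δ t)
        = ∫⁻ t in Set.Ici (2 * δ), f (t - δ) :=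
          setLIntegral_congr_fun measurableSet_Ici fun t ht => by
            simp only [softStart_of_le hδ ht]
      _ = ∫⁻ t, (Set.Ici δ).indicator f (t - δ) := by
          rw [← lintegral_indicator measurableSet_Ici]
          refine lintegral_congr fun t => ?_
          have : t ∈ Set.Ici (2 * δ) ↔ t - δ ∈ Set.Ici δ := by
            simp only [Set.mem_Ici]; constructor <;> intro h <;> linarith
          by_cases h : t ∈ Set.Ici (2 * δ)
          · rw [Set.indicator_of_mem h, Set.indicator_of_mem (this.1 h)]
          · rw [Set.indicator_of_notMem h, Set.indicator_of_notMem (mt this.2 h)]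
      _ = ∫⁻ t in Set.Ici δ, f t := by
          rw [lintegral_sub_right_eq_self, lintegral_indicator measurableSet_Ici]
      _ ≤ ∫⁻ t in Set.Ici 0, f t :=
          lintegral_mono_set (Set.Ici_subset_Ici.2 hδ.le)
  · calc ∫⁻ t in Set.Ico 0 (2 * δ), f (softStart δ t)
        ≤ ∫⁻ _ in Set.Ico 0 (2 * δ), C :=
          setLIntegral_mono' measurableSet_Ico fun t ht =>
            hf _ (softStart_mem_Icc hδ (Set.Ico_subset_Icc_self ht))
      _ = C * ENNReal.ofReal (2 * δ) := by simp

/-- The integrand of the action of the curve `γ` in the potential `W`. -/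
noncomputable def actionDensity {E : Type*} [NormedAddCommGroup E] [NormedSpace ℝ E]
    (W : E → ℝ) (γ : ℝ → E) (t : ℝ) : ℝ≥0∞ :=
  ENNReal.ofReal ((1 / 2) * ‖deriv γ t‖ ^ 2 + W (γ t))

section ActionDensity

variable {E : Type*} [NormedAddCommGroup E] [NormedSpace ℝ E] {W : E → ℝ} {γ : ℝ → E}

lemma actionDensity_le_of_deriv_eq_smul {c : ℝ → E} {s t r : ℝ} (hr : |r| ≤ 1)
    (hd : deriv c t = r • deriv γ s) (hc : c t = γ s) :
    actionDensity W c t ≤ actionDensity W γ s := by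
  unfold actionDensity
  rw [hd, hc, norm_smul, Real.norm_eq_abs]
  have : |r| * ‖deriv γ s‖ ≤ ‖deriv γ s‖ := mul_le_of_le_one_left (norm_nonneg _) hr
  gcongr

lemma exists_actionDensity_le (hW : Continuous W) (hγ : ContDiff ℝ 1 γ) {K : Set ℝ}
    (hK : IsCompact K) : ∃ C : ℝ, ∀ t ∈ K, actionDensity W γ t ≤ ENNReal.ofReal C := by
  have h1 := hγ.continuous_deriv le_rfl
  have h2 := hγ.continuous
  obtain ⟨C, hC⟩ := hK.exists_bound_of_continuousOn
    (f := fun t => (1 / 2) * ‖deriv γ t‖ ^ 2 + W (γ t)) (by fun_prop)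
  exact ⟨C, fun t ht => ENNReal.ofReal_le_ofReal ((le_abs_self _).trans (hC t ht))⟩

end ActionDensity

lemma actionDist_le_of_endpoint {n : ℕ} {W : EuclideanSpace ℝ (Fin n) → ℝ}
    {a : EuclideanSpace ℝ (Fin n)} {c : ℝ → EuclideanSpace ℝ (Fin n)} (hc : ContDiff ℝ 1 c)
    (hca : Tendsto c atBot (nhds a)) (T : ℝ) :
    actionDist n W a (c T) ≤ ∫⁻ t in Set.Iic T, actionDensity W c t := by
  have hd : ∀ t, deriv (fun t => c (t + T)) t = deriv c (t + T) := fun t =>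
    deriv_comp_add_const c T t
  refine (iInf_le _ ⟨fun t => c (t + T), hc.comp (by fun_prop),
    hca.comp (tendsto_atBot_add_const_right _ _ tendsto_id), by simp⟩).trans_eq ?_
  simp only [hd]
  rw [← lintegral_indicator measurableSet_Iic, ← lintegral_indicator measurableSet_Iic,
    ← lintegral_add_right_eq_self ((Set.Iic T).indicator _) T]
  refine lintegral_congr fun t => ?_
  simp [Set.indicator_apply, actionDensity]

/-- Concatenating two `C¹` curves does not increase the action beyond the sum of the actions,
even though the concatenation may have a corner. -/
lemma actionDist_le_add {n : ℕ} {W : EuclideanSpace ℝ (Fin n) → ℝ} (hW : Continuous W)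
    {a : EuclideanSpace ℝ (Fin n)} {γ₁ γ₂ : ℝ → EuclideanSpace ℝ (Fin n)}
    (h₁ : ContDiff ℝ 1 γ₁) (h₂ : ContDiff ℝ 1 γ₂) (ha : Tendsto γ₁ atBot (nhds a))
    (h₀ : γ₁ 0 = γ₂ 0) {T : ℝ} (hT : 0 < T) :
    actionDist n W a (γ₂ T) ≤ (∫⁻ t in Set.Iic 0, actionDensity W γ₁ t)
      + ∫⁻ t in Set.Icc 0 T, actionDensity W γ₂ t := by
  obtain ⟨C₁, hC₁⟩ := exists_actionDensity_le hW h₁ (isCompact_Icc (a := (-1 : ℝ)) (b := 0))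
  obtain ⟨C₂, hC₂⟩ := exists_actionDensity_le hW h₂ (isCompact_Icc (a := (0 : ℝ)) (b := 1))
  set A := ∫⁻ t in Set.Iic 0, actionDensity W γ₁ t with hA
  set B := ∫⁻ t in Set.Icc 0 T, actionDensity W γ₂ t with hB
  have key : ∀ δ : ℝ, 0 < δ → δ < 1 → δ < T → actionDist n W a (γ₂ T) ≤
      (A + ENNReal.ofReal C₁ * ENNReal.ofReal (2 * δ))
        + (B + ENNReal.ofReal C₂ * ENNReal.ofReal (2 * δ)) := by
    intro δ hδ hδ1 hδT
    set c : ℝ → EuclideanSpace ℝ (Fin n) :=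
      fun t => γ₁ (-softStart δ (-t)) + (γ₂ (softStart δ t) - γ₂ 0) with hcdef
    have hs := contDiff_softStart δ
    have hc : ContDiff ℝ 1 c :=
      (h₁.comp (hs.comp contDiff_neg).neg).add ((h₂.comp hs).sub contDiff_const)
    have hcneg : ∀ t ≤ 0, c t = γ₁ (-softStart δ (-t)) := fun t ht => by
      simp [hcdef, softStart_of_nonpos hδ ht]
    have hcpos : ∀ t, 0 ≤ t → c t = γ₂ (softStart δ t) := fun t ht => by
      simp [hcdef, softStart_of_nonpos hδ (neg_nonpos.2 ht), h₀]
    have hca : Tendsto c atBot (nhds a) := by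
      have h : Tendsto (fun t => γ₁ (t + δ)) atBot (nhds a) :=
        ha.comp (tendsto_atBot_add_const_right _ _ tendsto_id)
      refine h.congr' ?_
      filter_upwards [eventually_le_atBot (-(2 * δ))] with t ht
      rw [hcneg t (by linarith), softStart_of_le hδ (by linarith)]
      congr 1
      ring
    have hcT : c (T + δ) = γ₂ T := by
      rw [hcpos _ (by linarith), softStart_of_le hδ (by linarith), add_sub_cancel_right]
    have hdneg : ∀ t < 0, deriv c t =
        deriv (softStart δ) (-t) • deriv γ₁ (-softStart δ (-t)) := fun t ht => by
      have he : c =ᶠ[nhds t] fun t => γ₁ (-softStart δ (-t)) := by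
        filter_upwards [Iio_mem_nhds ht] with u hu using hcneg u (le_of_lt hu)
      have e := (hasDerivAt_softStart δ (-t)).scomp t (hasDerivAt_neg t)
      rw [← (hasDerivAt_softStart δ (-t)).deriv] at e
      have e2 := HasDerivAt.scomp t
        ((h₁.differentiable one_ne_zero _).hasDerivAt (x := -softStart δ (-t))) e.neg
      rw [he.deriv_eq]
      refine e2.deriv.trans ?_
      simp
    have hdpos : ∀ t, 0 < t → deriv c t =
        deriv (softStart δ) t • deriv γ₂ (softStart δ t) := fun t ht => by
      have he : c =ᶠ[nhds t] fun t => γ₂ (softStart δ t) := by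
        filter_upwards [Ioi_mem_nhds ht] with u hu using hcpos u (le_of_lt hu)
      have e := (hasDerivAt_softStart δ t)
      rw [← e.deriv] at e
      have e2 := HasDerivAt.scomp t
        ((h₂.differentiable one_ne_zero _).hasDerivAt (x := softStart δ t)) e
      rw [he.deriv_eq]
      exact e2.deriv
    have habs : ∀ t, |deriv (softStart δ) t| ≤ 1 := fun t => by
      rw [abs_of_nonneg (deriv_softStart_mem_Icc δ t).1]
      exact (deriv_softStart_mem_Icc δ t).2
    have hfirst : ∫⁻ t in Set.Iio 0, actionDensity W c t ≤
        A + ENNReal.ofReal C₁ * ENNReal.ofReal (2 * δ) := by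
      have hneg : ∀ f : ℝ → ℝ≥0∞, ∫⁻ t in Set.Iic 0, f t = ∫⁻ t in Set.Ici 0, f (-t) := by
        intro f
        rw [← lintegral_indicator measurableSet_Iic, ← lintegral_indicator measurableSet_Ici,
          ← lintegral_neg_eq_self]
        refine lintegral_congr fun t => ?_
        simp [Set.indicator_apply]
      calc ∫⁻ t in Set.Iio 0, actionDensity W c t
          ≤ ∫⁻ t in Set.Iio 0, actionDensity W γ₁ (-softStart δ (-t)) :=
            setLIntegral_mono' measurableSet_Iio fun t ht =>
              actionDensity_le_of_deriv_eq_smul (habs _) (hdneg t ht) (hcneg t (le_of_lt ht))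
        _ ≤ ∫⁻ t in Set.Iic 0, actionDensity W γ₁ (-softStart δ (-t)) :=
            lintegral_mono_set Set.Iio_subset_Iic_self
        _ = ∫⁻ t in Set.Ici 0, actionDensity W γ₁ (-softStart δ t) := by
            rw [hneg]; simp only [neg_neg]
        _ ≤ _ := by
            rw [hA, hneg]
            exact lintegral_comp_softStart_le hδ (fun s => actionDensity W γ₁ (-s))
              fun t ht => hC₁ _ ⟨by linarith [ht.2], by linarith [ht.1]⟩
    have hsecond : ∫⁻ t in Set.Ioc 0 (T + δ), actionDensity W c t ≤
        B + ENNReal.ofReal C₂ * ENNReal.ofReal (2 * δ) := by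
      calc ∫⁻ t in Set.Ioc 0 (T + δ), actionDensity W c t
          ≤ ∫⁻ t in Set.Ioc 0 (T + δ),
              (Set.Iic T).indicator (actionDensity W γ₂) (softStart δ t) :=
            setLIntegral_mono' measurableSet_Ioc fun t ht => by
              have : softStart δ t ∈ Set.Iic T := by
                have := monotone_softStart δ ht.2
                rwa [softStart_of_le (t := T + δ) hδ (by linarith), add_sub_cancel_right] at this
              rw [Set.indicator_of_mem this]
              exact actionDensity_le_of_deriv_eq_smul (habs _) (hdpos t ht.1)
                (hcpos t (le_of_lt ht.1))
        _ ≤ ∫⁻ t in Set.Ici 0, (Set.Iic T).indicator (actionDensity W γ₂) (softStart δ t) :=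
            lintegral_mono_set fun t ht => le_of_lt ht.1
        _ ≤ _ := lintegral_comp_softStart_le hδ _ fun t ht =>
            (Set.indicator_le_self _ _ _).trans (hC₂ _ ⟨ht.1, by linarith [ht.2]⟩)
        _ = _ := by
            rw [setLIntegral_indicator measurableSet_Iic, hB, Set.inter_comm, Set.Ici_inter_Iic]
    rw [← hcT]
    refine (actionDist_le_of_endpoint hc hca _).trans ?_
    rw [← Set.Iic_union_Ioc_eq_Iic (show (0 : ℝ) ≤ T + δ by linarith)]
    refine (lintegral_union_le _ _ _).trans (add_le_add ?_ hsecond)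
    rwa [← setLIntegral_congr Iio_ae_eq_Iic]
  have hlim : Tendsto (fun δ : ℝ => (A + ENNReal.ofReal C₁ * ENNReal.ofReal (2 * δ))
        + (B + ENNReal.ofReal C₂ * ENNReal.ofReal (2 * δ))) (nhdsWithin 0 (Set.Ioi 0))
        (nhds ((A + ENNReal.ofReal C₁ * 0) + (B + ENNReal.ofReal C₂ * 0))) := by
    have h : Tendsto (fun δ : ℝ => ENNReal.ofReal (2 * δ)) (nhdsWithin 0 (Set.Ioi 0))
        (nhds 0) := by
      have : Continuous fun δ : ℝ => ENNReal.ofReal (2 * δ) :=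
        ENNReal.continuous_ofReal.comp (by fun_prop)
      simpa using (this.tendsto 0).mono_left nhdsWithin_le_nhds
    exact (tendsto_const_nhds.add (ENNReal.Tendsto.const_mul h (Or.inr ENNReal.ofReal_ne_top))).add
      (tendsto_const_nhds.add (ENNReal.Tendsto.const_mul h (Or.inr ENNReal.ofReal_ne_top)))
  simp only [mul_zero, add_zero] at hlim
  refine ge_of_tendsto hlim ?_
  filter_upwards [Ioo_mem_nhdsGT (show (0 : ℝ) < min 1 T from lt_min one_pos hT)] with δ hδ
  exact key δ hδ.1 (hδ.2.trans_le (min_le_left _ _)) (hδ.2.trans_le (min_le_right _ _))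

/-- A scalar autonomous equation with continuous, positive and bounded speed has a global
solution which crosses the unit interval. -/
lemma exists_contDiff_hasDerivAt_comp {g : ℝ → ℝ} (hg : Continuous g) (hpos : ∀ s, 0 < g s)
    {M : ℝ} (hM : ∀ s, g s ≤ M) :
    ∃ (σ : ℝ → ℝ) (T : ℝ), 0 < T ∧ σ 0 = 0 ∧ σ T = 1 ∧ Monotone σ ∧ ContDiff ℝ 1 σ ∧
      ∀ t, HasDerivAt σ (g (σ t)) t := by
  have hM0 : 0 < M := (hpos 0).trans_le (hM 0)
  have hq : Continuous fun s => (g s)⁻¹ := hg.inv₀ fun s => (hpos s).ne'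
  set τ : ℝ → ℝ := fun s => ∫ u in (0 : ℝ)..s, (g u)⁻¹ with hτ
  have hd : ∀ s, HasDerivAt τ (g s)⁻¹ s := fun s =>
    intervalIntegral.integral_hasDerivAt_right (hq.intervalIntegrable _ _)
      (hq.stronglyMeasurableAtFilter _ _) hq.continuousAt
  have hderiv : deriv τ = fun s => (g s)⁻¹ := funext fun s => (hd s).deriv
  have hdiff : Differentiable ℝ τ := fun s => (hd s).differentiableAt
  have hτ1 : ContDiff ℝ 1 τ := contDiff_one_iff_deriv.2 ⟨hdiff, hderiv ▸ hq⟩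
  have hmono : StrictMono τ := strictMono_of_deriv_pos fun s => by
    rw [(hd s).deriv]; exact inv_pos.2 (hpos s)
  have hτ0 : τ 0 = 0 := by simp [hτ]
  have hgrow : Monotone fun s => τ s - M⁻¹ * s := by
    have hd' : ∀ s, HasDerivAt (fun s => τ s - M⁻¹ * s) ((g s)⁻¹ - M⁻¹ * 1) s := fun s =>
      (hd s).sub ((hasDerivAt_id s).const_mul _)
    refine monotone_of_deriv_nonneg (fun s => (hd' s).differentiableAt) fun s => ?_
    rw [(hd' s).deriv, mul_one, sub_nonneg]
    exact inv_anti₀ (hpos s) (hM s)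
  have htop : Tendsto τ atTop atTop := by
    refine tendsto_atTop_mono' _ ?_ (tendsto_id.const_mul_atTop (inv_pos.2 hM0))
    filter_upwards [eventually_ge_atTop 0] with s hs
    have := hgrow hs
    simp only [hτ0, id] at this ⊢
    linarith
  have hbot : Tendsto τ atBot atBot := by
    refine tendsto_atBot_mono' _ ?_ (tendsto_id.const_mul_atBot (inv_pos.2 hM0))
    filter_upwards [eventually_le_atBot 0] with s hs
    have := hgrow hs
    simp only [hτ0, id] at this ⊢
    linarith
  set e : ℝ ≃o ℝ := hmono.orderIsoOfSurjective τ (hdiff.continuous.surjective htop hbot)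
  have hsymm : ∀ t, τ (e.symm t) = t := fun t => e.apply_symm_apply t
  have hsymm' : ∀ s, e.symm (τ s) = s := fun s => e.symm_apply_apply s
  have hσd : ∀ t, HasDerivAt e.symm (g (e.symm t)) t := fun t => by
    have := HasDerivAt.of_local_left_inverse (e.symm.continuous.continuousAt (x := t))
      (hd (e.symm t)) (inv_ne_zero (hpos _).ne') (Eventually.of_forall hsymm)
    rwa [inv_inv] at this
  refine ⟨e.symm, τ 1, ?_, ?_, hsymm' 1, e.symm.monotone, ?_, hσd⟩
  · rw [← hτ0]; exact hmono one_pos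
  · have := hsymm' 0
    rwa [hτ0] at this
  · refine contDiff_one_iff_deriv.2 ⟨fun t => (hσd t).differentiableAt, ?_⟩
    rw [show deriv e.symm = fun t => g (e.symm t) from funext fun t => (hσd t).deriv]
    exact hg.comp e.symm.continuous

/-- The straight segment can be traversed with action arbitrarily close to its Jacobi length. -/
lemma exists_segment_action_le {E : Type*} [NormedAddCommGroup E] [NormedSpace ℝ E] {W : E → ℝ}
    (hW : Continuous W) (hWpos : ∀ p, 0 ≤ W p) {x v : E} (hv : v ≠ 0) {η : ℝ} (hη : 0 < η) :
    ∃ (γ : ℝ → E) (T : ℝ), 0 < T ∧ ContDiff ℝ 1 γ ∧ γ 0 = x ∧ γ T = x + v ∧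
      ∫⁻ t in Set.Icc 0 T, actionDensity W γ t ≤
        ENNReal.ofReal (‖v‖ * ((∫ t in (0 : ℝ)..1, √(2 * W (x + t • v))) + √(2 * η))) := by
  have hL : 0 < ‖v‖ := norm_pos_iff.2 hv
  set k : ℝ → ℝ := fun s => √(2 * (W (x + s • v) + η)) with hk
  have hkc : Continuous k := by fun_prop
  have hk2 : ∀ s, k s ^ 2 = 2 * (W (x + s • v) + η) := fun s =>
    Real.sq_sqrt (by linarith [hWpos (x + s • v)])
  have hkpos : ∀ s, 0 < k s := fun s => Real.sqrt_pos.2 (by linarith [hWpos (x + s • v)])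
  set g : ℝ → ℝ := fun s => k (max 0 (min 1 s)) / ‖v‖ with hg
  have hgc : Continuous g := by fun_prop
  obtain ⟨K, hK⟩ := (isCompact_Icc (a := (0 : ℝ)) (b := 1)).exists_bound_of_continuousOn
    hkc.continuousOn
  obtain ⟨σ, T, hT, hσ0, hσT, hσm, hσc, hσd⟩ := exists_contDiff_hasDerivAt_comp hgc
    (fun s => div_pos (hkpos _) hL) (M := K / ‖v‖) (fun s => by
      have := hK (max 0 (min 1 s)) ⟨le_max_left _ _, max_le zero_le_one (min_le_left _ _)⟩
      simp only [hg]
      gcongr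
      exact (le_abs_self _).trans this)
  refine ⟨fun t => x + σ t • v, T, hT, contDiff_const.add (hσc.smul contDiff_const),
    by simp [hσ0], by simp [hσT], ?_⟩
  have hdens : ∀ t ∈ Set.Icc 0 T, actionDensity W (fun t => x + σ t • v) t ≤
      ENNReal.ofReal (‖v‖ * k (σ t) * deriv σ t) := by
    intro t ht
    have h0 : 0 ≤ σ t := hσ0 ▸ hσm ht.1
    have h1 : σ t ≤ 1 := hσT ▸ hσm ht.2
    have hgk : g (σ t) = k (σ t) / ‖v‖ := by simp [hg, h0, h1]
    have hd : HasDerivAt (fun t => x + σ t • v) (g (σ t) • v) t :=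
      ((hσd t).smul_const v).const_add x
    have hnorm : ‖g (σ t) • v‖ = k (σ t) := by
      rw [norm_smul, hgk, Real.norm_of_nonneg (div_nonneg (hkpos _).le hL.le),
        div_mul_cancel₀ _ hL.ne']
    unfold actionDensity
    apply ENNReal.ofReal_le_ofReal
    rw [hd.deriv, hnorm, (hσd t).deriv, hgk,
      show ‖v‖ * k (σ t) * (k (σ t) / ‖v‖) = k (σ t) ^ 2 by field_simp, hk2]
    linarith
  have hσ' : Continuous (deriv σ) := hσc.continuous_deriv le_rfl
  have hσcont : Continuous σ := hσc.continuous
  have hcont : Continuous fun t => ‖v‖ * k (σ t) * deriv σ t := by fun_prop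
  have hσ'pos : ∀ t, 0 ≤ deriv σ t := fun t => hσm.deriv_nonneg
  calc ∫⁻ t in Set.Icc 0 T, actionDensity W (fun t => x + σ t • v) t
      ≤ ∫⁻ t in Set.Icc 0 T, ENNReal.ofReal (‖v‖ * k (σ t) * deriv σ t) :=
        setLIntegral_mono' measurableSet_Icc hdens
    _ = ENNReal.ofReal (∫ t in (0 : ℝ)..T, ‖v‖ * k (σ t) * deriv σ t) := by
        rw [intervalIntegral.integral_of_le hT.le, ← integral_Icc_eq_integral_Ioc,
          ofReal_integral_eq_lintegral_ofReal hcont.integrableOn_Icc]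
        exact Eventually.of_forall fun t =>
          mul_nonneg (mul_nonneg hL.le (hkpos _).le) (hσ'pos t)
    _ = ENNReal.ofReal (‖v‖ * ∫ s in (0 : ℝ)..1, k s) := by
        have := intervalIntegral.integral_comp_mul_deriv (a := 0) (b := T) (f := σ)
          (f' := deriv σ) (g := fun s => ‖v‖ * k s)
          (fun t _ => (hσd t).differentiableAt.hasDerivAt) hσ'.continuousOn (by fun_prop)
        rw [hσ0, hσT, intervalIntegral.integral_const_mul] at this
        rw [← this]
        rfl
    _ ≤ _ := by
        have hc : Continuous fun s : ℝ => √(2 * W (x + s • v)) := by fun_prop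
        have hle : ∫ s in (0 : ℝ)..1, k s ≤
            ∫ s in (0 : ℝ)..1, (√(2 * W (x + s • v)) + √(2 * η)) := by
          refine intervalIntegral.integral_mono_on zero_le_one (hkc.intervalIntegrable _ _)
            ((hc.add continuous_const).intervalIntegrable _ _) fun s _ => ?_
          simp only [hk, mul_add]
          have hw : 0 ≤ 2 * W (x + s • v) := mul_nonneg zero_le_two (hWpos _)
          refine Real.sqrt_le_iff.2 ⟨by positivity, ?_⟩
          nlinarith [Real.sq_sqrt hw, Real.sq_sqrt (show 0 ≤ 2 * η by positivity),
            mul_nonneg (Real.sqrt_nonneg (2 * W (x + s • v))) (Real.sqrt_nonneg (2 * η))]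
        rw [intervalIntegral.integral_add (hc.intervalIntegrable _ _) (by simp)] at hle
        simp only [intervalIntegral.integral_const, sub_zero, one_smul] at hle
        gcongr

/-- Subadditivity estimate for the action distance along a straight segment from `x` to `y`. -/
theorem actionDist_segment_bound
    (n : ℕ) (hn : 1 ≤ n) (W : EuclideanSpace ℝ (Fin n) → ℝ)
    (hW : Continuous W) (hWpos : ∀ p, 0 ≤ W p)
    (a x y : EuclideanSpace ℝ (Fin n)) :
    actionDist n W a y ≤ actionDist n W a x
      + ENNReal.ofReal (‖y - x‖ * ∫ t in (0:ℝ)..1, Real.sqrt (2 * W (x + t • (y - x)))) := by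
  rcases eq_or_ne y x with rfl | hxy
  · exact le_self_add
  have hv : y - x ≠ 0 := sub_ne_zero.2 hxy
  set I := ∫ t in (0:ℝ)..1, √(2 * W (x + t • (y - x)))
  have key : ∀ η : ℝ, 0 < η → actionDist n W a y ≤ actionDist n W a x
      + ENNReal.ofReal (‖y - x‖ * (I + √(2 * η))) := by
    intro η hη
    obtain ⟨γ₂, T, hT, h₂, h₂0, h₂T, hact⟩ := exists_segment_action_le hW hWpos hv hη (x := x)
    rw [add_sub_cancel] at h₂T
    unfold actionDist
    rw [ENNReal.iInf_add]
    refine le_iInf fun γ => ?_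
    have := actionDist_le_add hW γ.2.1 h₂ γ.2.2.1 (γ.2.2.2.trans h₂0.symm) hT
    rw [h₂T] at this
    exact this.trans (add_le_add le_rfl hact)
  have hlim : Tendsto (fun η : ℝ => actionDist n W a x
      + ENNReal.ofReal (‖y - x‖ * (I + √(2 * η)))) (nhdsWithin 0 (Set.Ioi 0))
      (nhds (actionDist n W a x + ENNReal.ofReal (‖y - x‖ * I))) := by
    have hc : Continuous fun η : ℝ => ENNReal.ofReal (‖y - x‖ * (I + √(2 * η))) :=
      ENNReal.continuous_ofReal.comp (by fun_prop)
    have h0 := (hc.tendsto 0).mono_left (nhdsWithin_le_nhds (s := Set.Ioi 0))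
    simp only [mul_zero, Real.sqrt_zero, add_zero] at h0
    exact tendsto_const_nhds.add h0
  exact ge_of_tendsto hlim (eventually_mem_nhdsWithin.mono key)
end

section
/- Let n ≥ 1, let W : ℝⁿ → ℝ be continuous and nonnegative with W(a) = 0 for some a ∈ ℝⁿ, and define d(x, a) as the infimum over continuously differentiable γ : ℝ → ℝⁿ with γ(t) → a as t → −∞ and γ(0) = x of ∫_{−∞}^0 ( ½‖γ'(t)‖² + W(γ(t)) ) dt. Then d(x, a) is finite for every x ∈ ℝⁿ, and the function x ↦ d(x, a) is locally Lipschitz on ℝⁿ. -/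
open Filter MeasureTheory
open scoped ENNReal

/-- Two functions whose values and derivatives agree at `0` glue to a differentiable function. -/
theorem hasDerivAt_ite_le_zero {E : Type*} [NormedAddCommGroup E] [NormedSpace ℝ E]
    {f g f' g' : ℝ → E} (hf : ∀ t, HasDerivAt f (f' t) t) (hg : ∀ t, HasDerivAt g (g' t) t)
    (h₀ : f 0 = g 0) (h₁ : f' 0 = g' 0) (t : ℝ) :
    HasDerivAt (fun t => if t ≤ 0 then f t else g t) (if t ≤ 0 then f' t else g' t) t := by
  rcases lt_trichotomy t 0 with ht | rfl | ht
  · rw [if_pos ht.le]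
    refine (hf t).congr_of_eventuallyEq ?_
    filter_upwards [Iio_mem_nhds ht] with s hs
    exact if_pos (le_of_lt hs)
  · rw [if_pos le_rfl, ← hasDerivWithinAt_univ, ← Set.Iic_union_Ici (a := (0 : ℝ))]
    refine HasDerivWithinAt.union ?_ ?_
    · exact (hf 0).hasDerivWithinAt.congr (fun s hs => if_pos hs) (if_pos le_rfl)
    · rw [h₁]
      refine (hg 0).hasDerivWithinAt.congr (fun s hs => ?_) (by simp [h₀])
      rcases (Set.mem_Ici.1 hs).eq_or_lt with rfl | hs
      · simp [h₀]
      · exact if_neg hs.not_ge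
  · rw [if_neg ht.not_ge]
    refine (hg t).congr_of_eventuallyEq ?_
    filter_upwards [Ioi_mem_nhds ht] with s hs
    exact if_neg (not_le_of_gt hs)

theorem setLIntegral_Iic_zero_comp_add_right (F : ℝ → ℝ≥0∞) {r : ℝ} (hr : 0 ≤ r) :
    ∫⁻ t in Set.Iic 0, F (t + r) = (∫⁻ t in Set.Iic 0, F t) + ∫⁻ t in Set.Ioc 0 r, F t := by
  have hpre : (fun t : ℝ => t + r) ⁻¹' Set.Iic r = Set.Iic 0 := by
    ext t; simp
  rw [← hpre, (measurePreserving_add_right volume r).setLIntegral_comp_preimage_emb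
    (measurableEmbedding_addRight r), hpre, ← Set.Iic_union_Ioc_eq_Iic hr,
    lintegral_union measurableSet_Ioc (Set.Iic_disjoint_Ioc le_rfl)]

/-- Continuing a competitor ending at `x` by a `C¹` curve `β` with matching velocity. -/
theorem actionDist_le_add_of_continuation {n : ℕ} {W : EuclideanSpace ℝ (Fin n) → ℝ}
    {a x y : EuclideanSpace ℝ (Fin n)} {γ β β' : ℝ → EuclideanSpace ℝ (Fin n)}
    (hγ : ContDiff ℝ 1 γ) (hγa : Tendsto γ atBot (nhds a)) (hγx : γ 0 = x)
    (hβ : ∀ t, HasDerivAt β (β' t) t) (hβ' : Continuous β') {r : ℝ} (hr : 0 < r)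
    (hβx : β 0 = x) (hβv : β' 0 = deriv γ 0) (hβy : β r = y) :
    actionDist n W a y ≤
      (∫⁻ t in Set.Iic (0 : ℝ), ENNReal.ofReal ((1 / 2) * ‖deriv γ t‖ ^ 2 + W (γ t))) +
      ∫⁻ t in Set.Ioc (0 : ℝ) r, ENNReal.ofReal ((1 / 2) * ‖β' t‖ ^ 2 + W (β t)) := by
  obtain ⟨hγd, hγc⟩ := contDiff_one_iff_deriv.1 hγ
  set η : ℝ → EuclideanSpace ℝ (Fin n) := fun t => if t ≤ 0 then γ t else β t with hη
  set η' : ℝ → EuclideanSpace ℝ (Fin n) := fun t => if t ≤ 0 then deriv γ t else β' t with hη'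
  have hd : ∀ t, HasDerivAt η (η' t) t :=
    hasDerivAt_ite_le_zero (fun t => (hγd t).hasDerivAt) hβ (hγx.trans hβx.symm) hβv.symm
  have hc : Continuous η' :=
    hγc.if_le hβ' continuous_id continuous_const (fun t ht => by
      have : t = 0 := ht
      rw [this, hβv])
  have hds : ∀ t, HasDerivAt (fun s => η (s + r)) (η' (t + r)) t :=
    fun t => (hd (t + r)).comp_add_const t r
  have hder : deriv (fun s => η (s + r)) = fun t => η' (t + r) := funext fun t => (hds t).deriv
  have hC : ContDiff ℝ 1 (fun s => η (s + r)) :=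
    contDiff_one_iff_deriv.2 ⟨fun t => (hds t).differentiableAt, by rw [hder]; fun_prop⟩
  have hT : Tendsto (fun s => η (s + r)) atBot (nhds a) := by
    have hη₀ : Tendsto η atBot (nhds a) := by
      refine hγa.congr' ?_
      filter_upwards [eventually_le_atBot 0] with s hs
      exact (if_pos hs).symm
    exact hη₀.comp (tendsto_atBot_add_const_right _ r tendsto_id)
  have hend : η (0 + r) = y := by simp [hη, hr.not_ge, hβy]
  refine (iInf_le _ ⟨_, hC, hT, hend⟩).trans_eq ?_
  simp only [hder]
  rw [setLIntegral_Iic_zero_comp_add_right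
    (fun t => ENNReal.ofReal ((1 / 2) * ‖η' t‖ ^ 2 + W (η t))) hr.le]
  congr 1
  · refine setLIntegral_congr_fun measurableSet_Iic fun t ht => ?_
    have ht : t ≤ 0 := ht
    simp [hη, hη', ht]
  · refine setLIntegral_congr_fun measurableSet_Ioc fun t ht => ?_
    have ht : ¬ t ≤ 0 := ht.1.not_ge
    simp [hη, hη', ht]

theorem setLIntegral_Ioc_ofReal_exp_add_const_le {r δ A C : ℝ} (hr : 0 ≤ r) (hδ : 0 < δ)
    (hA : 0 ≤ A) (hC : 0 ≤ C) :
    ∫⁻ t in Set.Ioc 0 r, ENNReal.ofReal (A * Real.exp (-t / δ) + C) ≤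
      ENNReal.ofReal (A * δ + C * r) := by
  have hcont : Continuous fun t : ℝ => A * Real.exp (-t / δ) + C := by fun_prop
  rw [← ofReal_integral_eq_lintegral_ofReal
    ((hcont.intervalIntegrable 0 r).1) (ae_of_all _ fun t => by positivity),
    ← intervalIntegral.integral_of_le hr]
  refine ENNReal.ofReal_le_ofReal ?_
  have hd : ∀ t ∈ Set.uIcc 0 r, HasDerivAt (fun t => -(A * δ) * Real.exp (-t / δ) + C * t)
      (A * Real.exp (-t / δ) + C) t := by
    intro t _
    have h₁ : HasDerivAt (fun t : ℝ => -t / δ) (-1 / δ) t := (hasDerivAt_id t).neg.div_const δ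
    refine ((h₁.exp.const_mul (-(A * δ))).add ((hasDerivAt_id t).const_mul C)).congr_deriv ?_
    field_simp
  rw [intervalIntegral.integral_eq_sub_of_hasDerivAt hd (hcont.intervalIntegrable 0 r)]
  have : 0 ≤ A * δ * Real.exp (-r / δ) := by positivity
  simp
  linarith

/-- The action distance grows at most linearly along a short hop from `x` to `y`, with a constant
that only depends on a bound of the potential near `x`. -/
theorem actionDist_le_add_ofReal_mul_norm {n : ℕ} {W : EuclideanSpace ℝ (Fin n) → ℝ}
    (a : EuclideanSpace ℝ (Fin n)) {x y : EuclideanSpace ℝ (Fin n)} {M : ℝ} (hM : 0 ≤ M)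
    (hWM : ∀ p ∈ Metric.closedBall x (3 * ‖y - x‖), W p ≤ M) :
    actionDist n W a y ≤ actionDist n W a x + ENNReal.ofReal ((17 + M) * ‖y - x‖) := by
  rcases eq_or_ne y x with rfl | hxy
  · simp
  have hr : 0 < ‖y - x‖ := norm_pos_iff.2 (sub_ne_zero.2 hxy)
  set r := ‖y - x‖ with hrdef
  conv_rhs => rw [actionDist, ENNReal.iInf_add]
  refine le_iInf fun ⟨γ, hγ, hγa, hγx⟩ => ?_
  set v := deriv γ 0 with hv
  set δ : ℝ := r / (1 + ‖v‖ ^ 2) with hδdef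
  have hδ : 0 < δ := by positivity
  have hδr : δ * (1 + ‖v‖ ^ 2) = r := by rw [hδdef]; field_simp
  have hδv : δ * ‖v‖ ≤ r := by
    rw [← hδr]; exact mul_le_mul_of_nonneg_left (by nlinarith [sq_nonneg (‖v‖ - 1)]) hδ.le
  have hδv2 : ‖v‖ ^ 2 * δ ≤ r := by nlinarith
  have hg : ∀ t : ℝ, 0 ≤ t → 0 ≤ δ * (1 - Real.exp (-t / δ)) ∧
      δ * (1 - Real.exp (-t / δ)) ≤ δ := by
    intro t ht
    have h₁ : Real.exp (-t / δ) ≤ 1 :=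
      Real.exp_le_one_iff.2 (div_nonpos_of_nonpos_of_nonneg (by linarith) hδ.le)
    have h₂ := Real.exp_pos (-t / δ)
    constructor <;> nlinarith
  have hgv : ∀ t : ℝ, 0 ≤ t → ‖(δ * (1 - Real.exp (-t / δ))) • v‖ ≤ r := by
    intro t ht
    rw [norm_smul, Real.norm_of_nonneg (hg t ht).1]
    exact (mul_le_mul_of_nonneg_right (hg t ht).2 (norm_nonneg v)).trans hδv
  set w := y - x - (δ * (1 - Real.exp (-r / δ))) • v with hw
  have hwn : ‖w‖ ≤ 2 * r := by
    refine (norm_sub_le _ _).trans ?_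
    linarith [hgv r hr.le]
  set β : ℝ → EuclideanSpace ℝ (Fin n) :=
    fun t => x + (δ * (1 - Real.exp (-t / δ))) • v + (t / r) ^ 2 • w with hβdef
  set β' : ℝ → EuclideanSpace ℝ (Fin n) :=
    fun t => Real.exp (-t / δ) • v + (2 * t / r ^ 2) • w with hβ'def
  have hβ : ∀ t, HasDerivAt β (β' t) t := by
    intro t
    have h₁ : HasDerivAt (fun t : ℝ => δ * (1 - Real.exp (-t / δ))) (Real.exp (-t / δ)) t := by
      have h : HasDerivAt (fun t : ℝ => -t / δ) (-1 / δ) t := (hasDerivAt_id t).neg.div_const δ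
      refine ((h.exp.const_sub 1).const_mul δ).congr_deriv ?_
      field_simp
    have h₂ : HasDerivAt (fun t : ℝ => (t / r) ^ 2) (2 * t / r ^ 2) t := by
      refine (((hasDerivAt_id t).div_const r).pow 2).congr_deriv ?_
      simp
      field_simp
    exact ((h₁.smul_const v).const_add x).add (h₂.smul_const w)
  refine (actionDist_le_add_of_continuation hγ hγa hγx hβ (by fun_prop) hr
    (by simp [hβdef]) (by simp [hβ'def, hv]) (y := y) ?_).trans ?_
  · simp [hβdef, hw, hr.ne']
  refine add_le_add_right ?_ _
  calc ∫⁻ t in Set.Ioc (0 : ℝ) r, ENNReal.ofReal ((1 / 2) * ‖β' t‖ ^ 2 + W (β t))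
      ≤ ∫⁻ t in Set.Ioc (0 : ℝ) r,
          ENNReal.ofReal (‖v‖ ^ 2 * Real.exp (-t / δ) + (16 + M)) := by
        refine setLIntegral_mono (by fun_prop) fun t ht => ENNReal.ofReal_le_ofReal ?_
        have hW : W (β t) ≤ M := by
          refine hWM _ ?_
          rw [mem_closedBall_iff_norm, show β t - x =
            (δ * (1 - Real.exp (-t / δ))) • v + (t / r) ^ 2 • w by simp only [hβdef]; abel]
          refine (norm_add_le _ _).trans ?_
          have h₁ : ‖(t / r) ^ 2 • w‖ ≤ ‖w‖ := by
            rw [norm_smul, Real.norm_of_nonneg (sq_nonneg _)]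
            refine mul_le_of_le_one_left (norm_nonneg _) (pow_le_one₀ ?_ ?_)
            · exact div_nonneg ht.1.le hr.le
            · exact (div_le_one hr).2 ht.2
          linarith [hgv t ht.1.le]
        have he : Real.exp (-t / δ) ≤ 1 := Real.exp_le_one_iff.2
          (div_nonpos_of_nonpos_of_nonneg (by linarith [ht.1]) hδ.le)
        have he₀ := Real.exp_pos (-t / δ)
        have hn : ‖β' t‖ ≤ Real.exp (-t / δ) * ‖v‖ + 4 := by
          refine (norm_add_le _ _).trans (add_le_add ?_ ?_)
          · rw [norm_smul, Real.norm_of_nonneg he₀.le]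
          · have hc : 0 ≤ 2 * t / r ^ 2 := div_nonneg (by linarith [ht.1]) (sq_nonneg r)
            rw [norm_smul, Real.norm_of_nonneg hc]
            refine (mul_le_mul_of_nonneg_left hwn hc).trans ?_
            rw [div_mul_eq_mul_div, div_le_iff₀ (by positivity)]
            nlinarith [ht.2]
        have hsq : ‖β' t‖ ^ 2 ≤ (Real.exp (-t / δ) * ‖v‖ + 4) ^ 2 :=
          pow_le_pow_left₀ (norm_nonneg _) hn 2
        have hee : (Real.exp (-t / δ) * ‖v‖) ^ 2 ≤ ‖v‖ ^ 2 * Real.exp (-t / δ) := by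
          have : 0 ≤ ‖v‖ ^ 2 * Real.exp (-t / δ) * (1 - Real.exp (-t / δ)) :=
            mul_nonneg (by positivity) (by linarith)
          nlinarith
        nlinarith [sq_nonneg (Real.exp (-t / δ) * ‖v‖ - 4)]
    _ ≤ ENNReal.ofReal (‖v‖ ^ 2 * δ + (16 + M) * r) :=
        setLIntegral_Ioc_ofReal_exp_add_const_le hr.le hδ (by positivity) (by positivity)
    _ ≤ ENNReal.ofReal ((17 + M) * r) := ENNReal.ofReal_le_ofReal (by linarith)

theorem actionDist_self {n : ℕ} {W : EuclideanSpace ℝ (Fin n) → ℝ}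
    {a : EuclideanSpace ℝ (Fin n)} (hWa : W a = 0) : actionDist n W a a = 0 := by
  refine le_antisymm ?_ zero_le
  refine (iInf_le _ ⟨fun _ => a, contDiff_const, tendsto_const_nhds, rfl⟩).trans_eq ?_
  simp [hWa]

theorem Continuous.exists_nonneg_bound_closedBall {n : ℕ} {W : EuclideanSpace ℝ (Fin n) → ℝ}
    (hW : Continuous W) (x : EuclideanSpace ℝ (Fin n)) (R : ℝ) :
    ∃ M, 0 ≤ M ∧ ∀ p ∈ Metric.closedBall x R, W p ≤ M := by
  obtain ⟨M, hM⟩ := (isCompact_closedBall x R).bddAbove_image hW.continuousOn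
  exact ⟨max M 0, le_max_right _ _,
    fun p hp => (hM (Set.mem_image_of_mem W hp)).trans (le_max_left _ _)⟩

/-- The action distance to a well of the potential is finite-valued and locally Lipschitz. -/
theorem actionDist_finite_locallyLipschitz
    (n : ℕ) (hn : 1 ≤ n) (W : EuclideanSpace ℝ (Fin n) → ℝ)
    (hW : Continuous W) (hWpos : ∀ p, 0 ≤ W p)
    (a : EuclideanSpace ℝ (Fin n)) (hWa : W a = 0) :
    (∀ x, actionDist n W a x ≠ ⊤) ∧
    LocallyLipschitz (fun x => (actionDist n W a x).toReal) := by
  have hfin : ∀ x, actionDist n W a x ≠ ⊤ := by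
    intro x
    obtain ⟨M, hM, hWM⟩ := hW.exists_nonneg_bound_closedBall a (3 * ‖x - a‖)
    have h := actionDist_le_add_ofReal_mul_norm a hM hWM
    rw [actionDist_self hWa, zero_add] at h
    exact ne_top_of_le_ne_top ENNReal.ofReal_ne_top h
  refine ⟨hfin, fun x₀ => ?_⟩
  obtain ⟨M, hM, hWM⟩ := hW.exists_nonneg_bound_closedBall x₀ 7
  refine ⟨⟨17 + M, by positivity⟩, Metric.ball x₀ 1, Metric.ball_mem_nhds x₀ one_pos, ?_⟩
  refine LipschitzOnWith.of_le_add_mul _ fun y hy x hx => ?_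
  have hx' : dist x x₀ < 1 := hx
  have hyx : ‖y - x‖ ≤ 2 := by
    rw [← dist_eq_norm]
    linarith [dist_triangle_right y x x₀, Metric.mem_ball.1 hy]
  have h := actionDist_le_add_ofReal_mul_norm (W := W) a hM (x := x) (y := y) fun p hp => by
    refine hWM p (Metric.mem_closedBall.2 ?_)
    linarith [dist_triangle p x x₀, Metric.mem_closedBall.1 hp]
  have h' := ENNReal.toReal_mono (ENNReal.add_ne_top.2 ⟨hfin x, ENNReal.ofReal_ne_top⟩) h
  rw [ENNReal.toReal_add (hfin x) ENNReal.ofReal_ne_top,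
    ENNReal.toReal_ofReal (by positivity), ← dist_eq_norm] at h'
  exact h'
end

section
/- Let n ≥ 1, let W : ℝⁿ → ℝ be continuous and nonnegative with W(a) = 0 for some a ∈ ℝⁿ, and let d(·, a) : ℝⁿ → ℝ be the (finite-valued) geodesic action distance to a. If d(·, a) is Fréchet differentiable at a point x ∈ ℝⁿ, then the operator norm of its derivative at x satisfies ‖D d(·,a)(x)‖ ≤ √(2 W(x)). -/
open Filter MeasureTheory
open scoped ENNReal

/-- A `C¹` curve can be continued past time `0`, as a `C¹` curve, so that its velocity becomes `v`
after a time `δ` by linear interpolation. -/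
lemma exists_contDiff_extension {E : Type*} [NormedAddCommGroup E] [NormedSpace ℝ E]
    [CompleteSpace E] {γ : ℝ → E} (hγ : ContDiff ℝ 1 γ) (v : E) {δ : ℝ} (hδ : 0 < δ) :
    ∃ c : ℝ → E, ContDiff ℝ 1 c ∧ (∀ t ≤ 0, c t = γ t) ∧ (∀ t ≤ 0, deriv c t = deriv γ t) ∧
      (∀ t, 0 ≤ t → ‖c t - (γ 0 + t • v)‖ ≤ δ * ‖deriv γ 0 - v‖) ∧
      (∀ t, 0 ≤ t → ‖deriv c t‖ ≤ ‖deriv γ 0‖ + ‖v‖) ∧ (∀ t, δ ≤ t → deriv c t = v) := by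
  set w := deriv γ 0 with hw
  have hγ' : Continuous (deriv γ) := hγ.continuous_deriv le_rfl
  have hγd : Differentiable ℝ γ := hγ.differentiable one_ne_zero
  set u : ℝ → E := fun t => deriv γ (min t 0) + min (max t 0 / δ) 1 • (v - w) with hu
  have huc : Continuous u := by fun_prop
  have hu_neg : ∀ t ≤ 0, u t = deriv γ t := by
    intro t ht
    simp [hu, min_eq_left ht, max_eq_right ht]
  have hu_pos : ∀ t, 0 ≤ t → u t = w + min (t / δ) 1 • (v - w) := by
    intro t ht
    simp [hu, min_eq_right ht, max_eq_left ht, hw]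
  have hu_late : ∀ t, δ ≤ t → u t = v := by
    intro t ht
    rw [hu_pos t (hδ.le.trans ht), min_eq_right ((one_le_div hδ).2 ht)]
    simp
  have hmin : ∀ t, 0 ≤ t → 0 ≤ min (t / δ) 1 ∧ min (t / δ) 1 ≤ 1 := fun t ht =>
    ⟨le_min (by positivity) zero_le_one, min_le_right _ _⟩
  have hu_bd : ∀ t, 0 ≤ t → ‖u t‖ ≤ ‖w‖ + ‖v‖ := by
    intro t ht
    obtain ⟨h0, h1⟩ := hmin t ht
    rw [hu_pos t ht]
    set m := min (t / δ) 1
    calc ‖w + m • (v - w)‖ = ‖(1 - m) • w + m • v‖ := by congr 1; module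
      _ ≤ ‖(1 - m) • w‖ + ‖m • v‖ := norm_add_le _ _
      _ = (1 - m) * ‖w‖ + m * ‖v‖ := by
        rw [norm_smul, norm_smul, Real.norm_of_nonneg h0, Real.norm_of_nonneg (by linarith)]
      _ ≤ ‖w‖ + ‖v‖ := by nlinarith [norm_nonneg w, norm_nonneg v]
  have hu_sub : ∀ t, 0 ≤ t → ‖u t - v‖ ≤ ‖w - v‖ := by
    intro t ht
    obtain ⟨h0, h1⟩ := hmin t ht
    rw [hu_pos t ht]
    set m := min (t / δ) 1
    calc ‖w + m • (v - w) - v‖ = ‖(1 - m) • (w - v)‖ := by congr 1; module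
      _ = (1 - m) * ‖w - v‖ := by rw [norm_smul, Real.norm_of_nonneg (by linarith)]
      _ ≤ ‖w - v‖ := by nlinarith [norm_nonneg (w - v)]
  set c : ℝ → E := fun t => γ 0 + ∫ τ in (0 : ℝ)..t, u τ with hc
  have hcd : ∀ t, HasDerivAt c (u t) t := fun t =>
    (intervalIntegral.integral_hasDerivAt_right (huc.intervalIntegrable _ _)
      (huc.stronglyMeasurableAtFilter _ _) huc.continuousAt).const_add _
  have hcd' : deriv c = u := funext fun t => (hcd t).deriv
  have hearly : ∀ t, 0 ≤ t → t ≤ δ → ‖∫ τ in (0 : ℝ)..t, (u τ - v)‖ ≤ δ * ‖w - v‖ := by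
    intro t ht htδ
    calc ‖∫ τ in (0 : ℝ)..t, (u τ - v)‖ ≤ ‖w - v‖ * |t - 0| := by
          apply intervalIntegral.norm_integral_le_of_norm_le_const
          intro τ hτ
          rw [Set.uIoc_of_le ht] at hτ
          exact hu_sub τ hτ.1.le
      _ ≤ δ * ‖w - v‖ := by
          rw [sub_zero, abs_of_nonneg ht, mul_comm]
          gcongr
  refine ⟨c, ?_, ?_, ?_, ?_, ?_, ?_⟩
  · rw [contDiff_one_iff_deriv, hcd']
    exact ⟨fun t => (hcd t).differentiableAt, huc⟩
  · intro t ht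
    have : ∫ τ in (0 : ℝ)..t, u τ = ∫ τ in (0 : ℝ)..t, deriv γ τ := by
      apply intervalIntegral.integral_congr
      intro τ hτ
      rw [Set.uIcc_of_ge ht] at hτ
      exact hu_neg τ hτ.2
    rw [hc]
    simp only
    rw [this, intervalIntegral.integral_deriv_eq_sub (fun τ _ => hγd τ)
      (hγ'.intervalIntegrable _ _)]
    abel
  · intro t ht
    rw [hcd', hu_neg t ht]
  · intro t ht
    have huv : Continuous fun τ => u τ - v := by fun_prop
    have : c t - (γ 0 + t • v) = ∫ τ in (0 : ℝ)..t, (u τ - v) := by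
      rw [intervalIntegral.integral_sub (huc.intervalIntegrable _ _) (by simp)]
      simp [hc]
    rw [this]
    rcases le_total t δ with h | h
    · exact hearly t ht h
    · rw [← intervalIntegral.integral_add_adjacent_intervals
        (huv.intervalIntegrable 0 δ) (huv.intervalIntegrable δ t)]
      have hz : ∫ τ in δ..t, (u τ - v) = 0 := by
        apply intervalIntegral.integral_zero_ae
        refine Eventually.of_forall fun τ hτ => ?_
        rw [Set.uIoc_of_le h] at hτ
        rw [hu_late τ hτ.1.le, sub_self]
      rw [hz, add_zero]
      exact hearly δ hδ.le le_rfl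
  · intro t ht
    rw [hcd']
    exact hu_bd t ht
  · intro t ht
    rw [hcd', hu_late t ht]

/-- The action distance to the endpoint at time `s` of a `C¹` curve is bounded by the action of
the curve up to time `s`. -/
lemma actionDist_le_setLIntegral_Iic {n : ℕ} (W : EuclideanSpace ℝ (Fin n) → ℝ)
    {a : EuclideanSpace ℝ (Fin n)} {c : ℝ → EuclideanSpace ℝ (Fin n)} (hc : ContDiff ℝ 1 c)
    (hca : Tendsto c atBot (nhds a)) (s : ℝ) :
    actionDist n W a (c s) ≤
      ∫⁻ t in Set.Iic s, ENNReal.ofReal ((1 / 2) * ‖deriv c t‖ ^ 2 + W (c t)) := by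
  refine (iInf_le _ ⟨fun t => c (t + s), hc.comp (contDiff_id.add contDiff_const),
    hca.comp (tendsto_atBot_add_const_right _ _ tendsto_id), by simp⟩).trans_eq ?_
  have hpre : (fun t : ℝ => t + s) ⁻¹' Set.Iic s = Set.Iic 0 := by
    ext t; simp
  rw [← (measurePreserving_add_right volume s).setLIntegral_comp_preimage_emb
    (measurableEmbedding_addRight s) _ (Set.Iic s), hpre]
  simp only [deriv_comp_add_const]

/-- Prolonging an admissible curve ending at `x` with velocity essentially equal to `v` for a
time `s` reaches a point close to `x + s • v`, at a controlled cost. -/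
lemma exists_actionDist_le_add {n : ℕ} {W : EuclideanSpace ℝ (Fin n) → ℝ}
    (hWpos : ∀ p, 0 ≤ W p) {a x : EuclideanSpace ℝ (Fin n)}
    {γ : ℝ → EuclideanSpace ℝ (Fin n)} (hγ : ContDiff ℝ 1 γ) (hγa : Tendsto γ atBot (nhds a))
    (hγx : γ 0 = x) {r M : ℝ} (hM : ∀ p ∈ Metric.ball x r, W p ≤ M)
    (v : EuclideanSpace ℝ (Fin n)) {s : ℝ} (hs : 0 < s) (hsr : s * ‖v‖ < r) {ε : ℝ} (hε : 0 < ε) :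
    ∃ y, ‖y - (x + s • v)‖ ≤ ε ∧ actionDist n W a y ≤
      (∫⁻ t in Set.Iic (0 : ℝ), ENNReal.ofReal ((1 / 2) * ‖deriv γ t‖ ^ 2 + W (γ t))) +
        ENNReal.ofReal (s * ((1 / 2) * ‖v‖ ^ 2 + M) + ε) := by
  have hr : 0 < r := lt_of_le_of_lt (by positivity) hsr
  have hM0 : 0 ≤ M := (hWpos x).trans (hM x (Metric.mem_ball_self hr))
  set K := ‖deriv γ 0 - v‖ with hK
  set C := (1 / 2) * (‖deriv γ 0‖ + ‖v‖) ^ 2 with hC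
  have hC0 : 0 ≤ C := by positivity
  obtain ⟨δ, hδ, hδK, hδr, hδC⟩ :
      ∃ δ : ℝ, 0 < δ ∧ δ * K ≤ ε ∧ s * ‖v‖ + δ * K < r ∧ C * δ ≤ ε := by
    have h1 : ∀ᶠ δ in nhdsWithin (0 : ℝ) (Set.Ioi 0), δ * K < ε :=
      nhdsWithin_le_nhds <| (by fun_prop : Continuous fun δ : ℝ => δ * K).continuousAt.eventually_lt
        continuousAt_const (by simpa using hε)
    have h2 : ∀ᶠ δ in nhdsWithin (0 : ℝ) (Set.Ioi 0), s * ‖v‖ + δ * K < r :=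
      nhdsWithin_le_nhds <| (by fun_prop : Continuous fun δ : ℝ =>
        s * ‖v‖ + δ * K).continuousAt.eventually_lt continuousAt_const (by simpa using hsr)
    have h3 : ∀ᶠ δ in nhdsWithin (0 : ℝ) (Set.Ioi 0), C * δ < ε :=
      nhdsWithin_le_nhds <| (by fun_prop : Continuous fun δ : ℝ => C * δ).continuousAt.eventually_lt
        continuousAt_const (by simpa using hε)
    obtain ⟨δ, h1, h2, h3, h4⟩ := (h1.and (h2.and (h3.and self_mem_nhdsWithin))).exists
    exact ⟨δ, h4, h1.le, h2, h3.le⟩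
  obtain ⟨c, hc, hcγ, hcγ', hcx, hcb, hcv⟩ := exists_contDiff_extension hγ v hδ
  have hca : Tendsto c atBot (nhds a) := hγa.congr' <| by
    filter_upwards [eventually_le_atBot (0 : ℝ)] with t ht using (hcγ t ht).symm
  rw [hγx] at hcx
  refine ⟨c s, (hcx s hs.le).trans hδK, (actionDist_le_setLIntegral_Iic W hc hca s).trans ?_⟩
  rw [← Set.Iic_union_Ioc_eq_Iic hs.le]
  refine (lintegral_union_le _ _ _).trans (add_le_add (le_of_eq ?_) ?_)
  · refine setLIntegral_congr_fun measurableSet_Iic fun t ht => ?_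
    simp only [hcγ t ht, hcγ' t ht]
  have hWc : ∀ t ∈ Set.Ioc 0 s, W (c t) ≤ M := by
    intro t ht
    refine hM _ ?_
    rw [mem_ball_iff_norm]
    calc ‖c t - x‖ = ‖(c t - (x + t • v)) + t • v‖ := by congr 1; abel
      _ ≤ δ * K + t * ‖v‖ := by
        refine (norm_add_le _ _).trans (add_le_add (hcx t ht.1.le) ?_)
        rw [norm_smul, Real.norm_of_nonneg ht.1.le]
      _ ≤ δ * K + s * ‖v‖ := by have := ht.2; gcongr
      _ < r := by linarith
  set A := (1 / 2) * ‖v‖ ^ 2 + M with hA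
  have hA0 : 0 ≤ A := by positivity
  have hpt : ∀ t ∈ Set.Ioc 0 s, ENNReal.ofReal ((1 / 2) * ‖deriv c t‖ ^ 2 + W (c t)) ≤
      ENNReal.ofReal A + (Set.Ioc 0 δ).indicator (fun _ => ENNReal.ofReal C) t := by
    intro t ht
    by_cases h : t ≤ δ
    · rw [Set.indicator_of_mem (show t ∈ Set.Ioc 0 δ from ⟨ht.1, h⟩), ← ENNReal.ofReal_add hA0 hC0]
      apply ENNReal.ofReal_le_ofReal
      have h1 : (1 / 2) * ‖deriv c t‖ ^ 2 ≤ C := by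
        have := hcb t ht.1.le
        rw [hC]; gcongr
      have := hWc t ht
      have : 0 ≤ (1 / 2) * ‖v‖ ^ 2 := by positivity
      linarith
    · rw [Set.indicator_of_notMem (fun h' => h h'.2), add_zero, hcv t (le_of_not_ge h)]
      apply ENNReal.ofReal_le_ofReal
      have := hWc t ht
      linarith
  calc ∫⁻ t in Set.Ioc 0 s, ENNReal.ofReal ((1 / 2) * ‖deriv c t‖ ^ 2 + W (c t))
      ≤ ∫⁻ t in Set.Ioc 0 s,
          (ENNReal.ofReal A + (Set.Ioc 0 δ).indicator (fun _ => ENNReal.ofReal C) t) :=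
        setLIntegral_mono' measurableSet_Ioc hpt
    _ = (∫⁻ _ in Set.Ioc 0 s, ENNReal.ofReal A) +
          ∫⁻ t in Set.Ioc 0 s, (Set.Ioc 0 δ).indicator (fun _ => ENNReal.ofReal C) t :=
        lintegral_add_left measurable_const _
    _ ≤ ENNReal.ofReal A * ENNReal.ofReal s + ENNReal.ofReal C * ENNReal.ofReal δ := by
        refine add_le_add (le_of_eq ?_) ((setLIntegral_le_lintegral _ _).trans_eq ?_)
        · rw [setLIntegral_const, Real.volume_Ioc, sub_zero]
        · rw [lintegral_indicator measurableSet_Ioc, setLIntegral_const, Real.volume_Ioc, sub_zero]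
    _ ≤ ENNReal.ofReal (s * A + ε) := by
        rw [← ENNReal.ofReal_mul hA0, ← ENNReal.ofReal_mul hC0,
          ← ENNReal.ofReal_add (by positivity) (by positivity)]
        apply ENNReal.ofReal_le_ofReal
        linarith

/-- Real-valued first-order upper bound for the action distance near a point. -/
lemma exists_toReal_actionDist_le {n : ℕ} {W : EuclideanSpace ℝ (Fin n) → ℝ}
    (hWpos : ∀ p, 0 ≤ W p) {a x : EuclideanSpace ℝ (Fin n)} (hfin : actionDist n W a x ≠ ⊤)
    {r M : ℝ} (hM : ∀ p ∈ Metric.ball x r, W p ≤ M)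
    (v : EuclideanSpace ℝ (Fin n)) {s : ℝ} (hs : 0 < s) (hsr : s * ‖v‖ < r) {ε : ℝ} (hε : 0 < ε) :
    ∃ y, ‖y - (x + s • v)‖ ≤ ε ∧ (actionDist n W a y).toReal ≤
      (actionDist n W a x).toReal + s * ((1 / 2) * ‖v‖ ^ 2 + M) + 2 * ε := by
  have hr : 0 < r := lt_of_le_of_lt (by positivity) hsr
  have hM0 : 0 ≤ M := (hWpos x).trans (hM x (Metric.mem_ball_self hr))
  have hlt : actionDist n W a x < actionDist n W a x + ENNReal.ofReal ε :=
    ENNReal.lt_add_right hfin (by simpa using hε)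
  obtain ⟨⟨γ, hγ, hγa, hγx⟩, hcost⟩ := iInf_lt_iff.1 hlt
  obtain ⟨y, hy, hle⟩ := exists_actionDist_le_add hWpos hγ hγa hγx hM v hs hsr hε
  refine ⟨y, hy, ?_⟩
  have h := hle.trans (add_le_add_left hcost.le _)
  have hB : 0 ≤ s * ((1 / 2) * ‖v‖ ^ 2 + M) + ε := by positivity
  have h2 := ENNReal.toReal_mono (by finiteness) h
  rw [ENNReal.toReal_add (by finiteness) (by finiteness), ENNReal.toReal_add hfin (by finiteness),
    ENNReal.toReal_ofReal hε.le, ENNReal.toReal_ofReal hB] at h2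
  linarith

/-- The derivative of the action distance satisfies the Hamilton–Jacobi inequality, in the form
dual to `½‖p‖² ≤ W x`. -/
lemma fderiv_actionDist_apply_le {n : ℕ} {W : EuclideanSpace ℝ (Fin n) → ℝ}
    (hW : Continuous W) (hWpos : ∀ p, 0 ≤ W p) {a x : EuclideanSpace ℝ (Fin n)}
    (hfin : actionDist n W a x ≠ ⊤)
    (hdiff : DifferentiableAt ℝ (fun y => (actionDist n W a y).toReal) x)
    (v : EuclideanSpace ℝ (Fin n)) :
    fderiv ℝ (fun y => (actionDist n W a y).toReal) x v ≤ (1 / 2) * ‖v‖ ^ 2 + W x := by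
  set f := fun y => (actionDist n W a y).toReal with hf
  refine le_of_forall_pos_le_add fun η hη => ?_
  obtain ⟨r, hr, hball⟩ := Metric.eventually_nhds_iff_ball.1
    (hW.continuousAt.eventually_lt continuousAt_const (lt_add_of_pos_right (W x) hη))
  have hM : ∀ p ∈ Metric.ball x r, W p ≤ W x + η := fun p hp => (hball p hp).le
  have hex : ∀ s : ℝ, ∃ y, 0 < s → s * ‖v‖ < r → ‖y - (x + s • v)‖ ≤ s ^ 2 ∧
      f y ≤ f x + s * ((1 / 2) * ‖v‖ ^ 2 + (W x + η)) + 2 * s ^ 2 := by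
    intro s
    by_cases hs : 0 < s ∧ s * ‖v‖ < r
    · obtain ⟨y, hy⟩ := exists_toReal_actionDist_le hWpos hfin hM v hs.1 hs.2
        (pow_pos hs.1 2)
      exact ⟨y, fun _ _ => hy⟩
    · exact ⟨x, fun h1 h2 => absurd ⟨h1, h2⟩ hs⟩
  choose y hy using hex
  have hsmall : ∀ᶠ s in nhdsWithin (0 : ℝ) (Set.Ioi 0), 0 < s ∧ s * ‖v‖ < r :=
    Eventually.and self_mem_nhdsWithin <| nhdsWithin_le_nhds <|
      (by fun_prop : Continuous fun s : ℝ => s * ‖v‖).continuousAt.eventually_lt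
        continuousAt_const (by simpa using hr)
  have hid : Tendsto (fun s : ℝ => s) (nhdsWithin (0 : ℝ) (Set.Ioi 0)) (nhds 0) :=
    nhdsWithin_le_nhds
  have hvel : Tendsto (fun s : ℝ => s⁻¹ • (y s - x)) (nhdsWithin (0 : ℝ) (Set.Ioi 0))
      (nhds v) := by
    rw [tendsto_iff_norm_sub_tendsto_zero]
    refine squeeze_zero' (Eventually.of_forall fun _ => norm_nonneg _) ?_ hid
    filter_upwards [hsmall] with s ⟨hs, hsr⟩
    have h1 : s⁻¹ • (y s - x) - v = s⁻¹ • (y s - (x + s • v)) := by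
      rw [← sub_sub, smul_sub _ _ (s • v), smul_smul, inv_mul_cancel₀ hs.ne', one_smul]
    rw [h1, norm_smul, norm_inv, Real.norm_of_nonneg hs.le]
    calc s⁻¹ * ‖y s - (x + s • v)‖ ≤ s⁻¹ * s ^ 2 := by gcongr; exact (hy s hs hsr).1
      _ = s := by field_simp
  have hlim : Tendsto (fun s : ℝ => s⁻¹ • (f (y s) - f x)) (nhdsWithin (0 : ℝ) (Set.Ioi 0))
      (nhds (fderiv ℝ f x v)) := by
    have hz : Tendsto (fun s : ℝ => y s - x) (nhdsWithin (0 : ℝ) (Set.Ioi 0)) (nhds 0) := by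
      have := hid.smul hvel
      rw [zero_smul] at this
      refine this.congr' ?_
      filter_upwards [hsmall] with s ⟨hs, _⟩
      rw [smul_smul, mul_inv_cancel₀ hs.ne', one_smul]
    have := hdiff.hasFDerivAt.hasFDerivWithinAt (s := Set.univ) |>.lim
      hz (Eventually.of_forall fun _ => Set.mem_univ _) hvel
    simpa using this
  have hbd : Tendsto (fun s : ℝ => (1 / 2) * ‖v‖ ^ 2 + (W x + η) + 2 * s)
      (nhdsWithin (0 : ℝ) (Set.Ioi 0)) (nhds ((1 / 2) * ‖v‖ ^ 2 + (W x + η) + 2 * 0)) :=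
    (hid.const_mul 2).const_add _
  have hfinal := le_of_tendsto_of_tendsto hlim hbd <| by
    filter_upwards [hsmall] with s ⟨hs, hsr⟩
    have h := (hy s hs hsr).2
    rw [smul_eq_mul, inv_mul_le_iff₀ hs]
    linarith
  linarith

/-- At a point of differentiability, the derivative of the action distance is bounded by
`√(2W)`. -/
theorem actionDist_deriv_bound
    (n : ℕ) (hn : 1 ≤ n) (W : EuclideanSpace ℝ (Fin n) → ℝ)
    (hW : Continuous W) (hWpos : ∀ p, 0 ≤ W p)
    (a : EuclideanSpace ℝ (Fin n)) (hWa : W a = 0)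
    (hfin : ∀ y, actionDist n W a y ≠ ⊤)
    (x : EuclideanSpace ℝ (Fin n))
    (hdiff : DifferentiableAt ℝ (fun y => (actionDist n W a y).toReal) x) :
    ‖fderiv ℝ (fun y => (actionDist n W a y).toReal) x‖ ≤ Real.sqrt (2 * W x) := by
  refine ContinuousLinearMap.opNorm_le_bound _ (Real.sqrt_nonneg _) fun v => ?_
  set L := fderiv ℝ (fun y => (actionDist n W a y).toReal) x with hL
  have key : ∀ v, L v ≤ (1 / 2) * ‖v‖ ^ 2 + W x :=
    fderiv_actionDist_apply_le hW hWpos (hfin x) hdiff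
  rcases eq_or_ne v 0 with rfl | hv
  · simp
  have hv' : 0 < ‖v‖ := norm_pos_iff.2 hv
  have h := key ((L v / ‖v‖ ^ 2) • v)
  rw [map_smul, norm_smul, smul_eq_mul, mul_pow, Real.norm_eq_abs, sq_abs] at h
  have h2 : (L v) ^ 2 / ‖v‖ ^ 2 ≤ 2 * W x := by
    have e1 : L v / ‖v‖ ^ 2 * L v = (L v) ^ 2 / ‖v‖ ^ 2 := by ring
    have e2 : (L v / ‖v‖ ^ 2) ^ 2 * ‖v‖ ^ 2 = (L v) ^ 2 / ‖v‖ ^ 2 := by field_simp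
    rw [e1, e2] at h
    linarith
  rw [← div_le_iff₀ hv']
  apply Real.le_sqrt_of_sq_le
  rwa [div_pow, Real.norm_eq_abs, sq_abs]
end

section
/- Let ε > 0 and ρ ≥ 0. The infimum, over all continuously differentiable r : ℝ → ℝ with r(t) → 1 as t → −∞ and r(0) = ρ, of ∫_{−∞}^0 ( ½ r'(t)² + (1 − r(t)²)²/(4ε²) ) dt equals (1 − ρ)² (ρ + 2) / (3 √2 ε). -/
open Filter MeasureTheory
open scoped ENNReal

namespace RadialAction

/-- A function that is `C¹` on `(-∞, a]` extends to a `C¹` function on the real line. -/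
theorem exists_contDiff_extension_of_hasDerivAt_Iic {f v : ℝ → ℝ} {a : ℝ}
    (hf : ∀ t ≤ a, HasDerivAt f (v t) t) (hv : ContinuousOn v (Set.Iic a)) :
    ∃ g : ℝ → ℝ, ContDiff ℝ 1 g ∧ ∀ t ≤ a, g t = f t ∧ HasDerivAt g (v t) t := by
  have hcont : Continuous fun s => v (min s a) :=
    hv.comp_continuous (by fun_prop) fun s => min_le_right s a
  have hderiv : ∀ t, HasDerivAt (fun u => f a + ∫ s in a..u, v (min s a)) (v (min t a)) t :=
    fun t => ((hcont.integral_hasStrictDerivAt a t).hasDerivAt).const_add _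
  refine ⟨_, contDiff_one_iff_deriv.2 ⟨fun t => (hderiv t).differentiableAt, ?_⟩,
    fun t ht => ⟨?_, ?_⟩⟩
  · rwa [funext fun t => (hderiv t).deriv]
  · have hint : ∫ s in a..t, v (min s a) = f t - f a := by
      refine intervalIntegral.integral_eq_sub_of_hasDerivAt (fun s hs => ?_)
        (hcont.intervalIntegrable _ _)
      rw [Set.uIcc_of_ge ht] at hs
      simpa only [min_eq_left hs.2] using hf s hs.2
    simp [hint]
  · simpa only [min_eq_left ht] using hderiv t

theorem ofReal_sub_le_lintegral_Iic {g g' L : ℝ → ℝ} {a m : ℝ}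
    (hg : ∀ t, HasDerivAt g (g' t) t) (hg' : Continuous g') (hm : Tendsto g atBot (nhds m))
    (hL : Continuous L) (hL0 : ∀ t, 0 ≤ L t) (hle : ∀ t, g' t ≤ L t) :
    ENNReal.ofReal (g a - m) ≤ ∫⁻ t in Set.Iic a, ENNReal.ofReal (L t) := by
  refine le_of_tendsto (ENNReal.tendsto_ofReal (hm.const_sub (g a))) ?_
  filter_upwards [eventually_le_atBot a] with T hT
  calc ENNReal.ofReal (g a - g T)
      = ENNReal.ofReal (∫ t in T..a, g' t) := by
        rw [intervalIntegral.integral_eq_sub_of_hasDerivAt (fun t _ => hg t)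
          (hg'.intervalIntegrable _ _)]
    _ ≤ ENNReal.ofReal (∫ t in T..a, L t) :=
        ENNReal.ofReal_le_ofReal (intervalIntegral.integral_mono_on hT
          (hg'.intervalIntegrable _ _) (hL.intervalIntegrable _ _) fun t _ => hle t)
    _ = ∫⁻ t in Set.Ioc T a, ENNReal.ofReal (L t) := by
        rw [intervalIntegral.integral_of_le hT]
        exact ofReal_integral_eq_lintegral_ofReal (hL.intervalIntegrable T a).1 (ae_of_all _ hL0)
    _ ≤ ∫⁻ t in Set.Iic a, ENNReal.ofReal (L t) :=
        lintegral_mono_set Set.Ioc_subset_Iic_self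

theorem lintegral_Iic_of_hasDerivAt_of_nonneg {g L : ℝ → ℝ} {a m : ℝ}
    (hg : ∀ t ≤ a, HasDerivAt g (L t) t) (hm : Tendsto g atBot (nhds m))
    (hL : Continuous L) (hL0 : ∀ t, 0 ≤ L t) :
    ∫⁻ t in Set.Iic a, ENNReal.ofReal (L t) = ENNReal.ofReal (g a - m) := by
  have hint : IntegrableOn L (Set.Iic a) := by
    refine integrableOn_Iic_of_intervalIntegral_norm_tendsto (l := atBot) (a := id) (g a - m) a
      (fun T => (hL.intervalIntegrable T a).1) tendsto_id ?_
    refine (hm.const_sub (g a)).congr' ?_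
    filter_upwards [eventually_le_atBot a] with T hT
    simp only [Real.norm_of_nonneg (hL0 _), id]
    refine (intervalIntegral.integral_eq_sub_of_hasDerivAt (fun t ht => hg t ?_)
      (hL.intervalIntegrable _ _)).symm
    rw [Set.uIcc_of_le hT] at ht
    exact ht.2
  rw [← integral_Iic_of_hasDerivAt_of_tendsto' hg hint hm]
  exact (ofReal_integral_eq_lintegral_ofReal hint (ae_of_all _ hL0)).symm

/-- The explicit solution of `r' = -c (1 - r²)` on `(-∞, 0]` with `r(-∞) = 1` and `r(0) = ρ`,
extended to the real line. -/
theorem exists_optimal_profile {c ρ : ℝ} (hc : 0 < c) (hρ : 0 ≤ ρ) :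
    ∃ r : ℝ → ℝ, ContDiff ℝ 1 r ∧ Tendsto r atBot (nhds 1) ∧ r 0 = ρ ∧
      ∀ t ≤ 0, HasDerivAt r (-c * (1 - r t ^ 2)) t := by
  set q : ℝ := (ρ - 1) / (ρ + 1) with hq
  have hq1 : q < 1 := by rw [hq, div_lt_one (by linarith)]; linarith
  set f : ℝ → ℝ := fun t => (1 + q * Real.exp (2 * c * t)) / (1 - q * Real.exp (2 * c * t))
    with hf
  have hne : ∀ t ≤ 0, 1 - q * Real.exp (2 * c * t) ≠ 0 := by
    intro t ht
    have h0 := Real.exp_pos (2 * c * t)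
    have h1 : Real.exp (2 * c * t) ≤ 1 := Real.exp_le_one_iff.2 (by nlinarith)
    nlinarith
  have hderiv : ∀ t ≤ 0, HasDerivAt f (-c * (1 - f t ^ 2)) t := by
    intro t ht
    have he : HasDerivAt (fun t => q * Real.exp (2 * c * t))
        (q * (Real.exp (2 * c * t) * (2 * c * 1))) t :=
      (((hasDerivAt_id t).const_mul (2 * c)).exp).const_mul q
    refine ((he.const_add 1).fun_div (he.const_sub 1) (hne t ht)).congr_deriv ?_
    have := hne t ht
    simp only [hf]
    field_simp
    ring
  obtain ⟨r, hr, hrf⟩ := exists_contDiff_extension_of_hasDerivAt_Iic hderiv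
    (((continuousOn_const).sub ((show ContinuousOn f (Set.Iic 0) from
      fun t ht => (hderiv t ht).continuousAt.continuousWithinAt).pow 2)).const_smul (-c))
  refine ⟨r, hr, ?_, ?_, fun t ht => (hrf t ht).1 ▸ (hrf t ht).2⟩
  · have hexp : Tendsto (fun t => q * Real.exp (2 * c * t)) atBot (nhds 0) := by
      simpa using (Real.tendsto_exp_atBot.comp
        (tendsto_id.const_mul_atBot (by positivity : 0 < 2 * c))).const_mul q
    have hlim : Tendsto f atBot (nhds 1) := by
      have h := (hexp.const_add 1).div (hexp.const_sub 1) (by norm_num)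
      rwa [add_zero, sub_zero, div_one] at h
    refine hlim.congr' ?_
    filter_upwards [eventually_le_atBot 0] with t ht using (hrf t ht).1.symm
  · rw [(hrf 0 le_rfl).1]
    have : ρ + 1 ≠ 0 := by positivity
    simp only [hf, hq, mul_zero, Real.exp_zero, mul_one]
    field_simp
    ring

end RadialAction

open RadialAction in
/-- The half-line action for the radial double-well potential `(1-r²)²/(4ε²)`, connecting the
value `1` at `-∞` to the value `ρ ≥ 0` at time `0`, equals `(1-ρ)²(ρ+2)/(3√2 ε)`. -/
theorem radial_action_value (ε ρ : ℝ) (hε : 0 < ε) (hρ : 0 ≤ ρ) :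
    (⨅ r : {r : ℝ → ℝ // ContDiff ℝ 1 r ∧ Tendsto r atBot (nhds 1) ∧ r 0 = ρ},
      ∫⁻ t in Set.Iic (0 : ℝ),
        ENNReal.ofReal ((1 / 2) * (deriv r.1 t) ^ 2 + (1 - (r.1 t) ^ 2) ^ 2 / (4 * ε ^ 2)))
    = ENNReal.ofReal ((1 - ρ) ^ 2 * (ρ + 2) / (3 * Real.sqrt 2 * ε)) := by
  set c : ℝ := 1 / (Real.sqrt 2 * ε) with hc_def
  have hc : 0 < c := by positivity
  have hW : ∀ x : ℝ, x / (4 * ε ^ 2) = c ^ 2 / 2 * x := by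
    intro x
    rw [hc_def, div_pow, mul_pow, Real.sq_sqrt zero_le_two]
    field_simp
    norm_num
  set F : ℝ → ℝ := fun x => c * (2 / 3 - x + x ^ 3 / 3) with hF
  have hFρ : (1 - ρ) ^ 2 * (ρ + 2) / (3 * Real.sqrt 2 * ε) = F ρ - 0 := by
    simp only [hF, hc_def]
    field_simp
    ring
  have hFderiv : ∀ {r : ℝ → ℝ} {v t : ℝ}, HasDerivAt r v t →
      HasDerivAt (fun t => F (r t)) (-c * (1 - r t ^ 2) * v) t := by
    intro r v t h
    refine (((h.const_sub (2 / 3)).fun_add ((h.fun_pow 3).div_const 3)).const_mul c).congr_deriv ?_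
    push_cast
    ring
  have hFlim : ∀ {r : ℝ → ℝ}, Tendsto r atBot (nhds 1) →
      Tendsto (fun t => F (r t)) atBot (nhds 0) := by
    intro r h
    have hcont : Continuous F := by fun_prop
    have h1 : F 1 = 0 := by norm_num [hF]
    exact h1 ▸ (hcont.tendsto 1).comp h
  simp only [hW]
  rw [hFρ]
  have hL : ∀ {r : ℝ → ℝ}, ContDiff ℝ 1 r →
      Continuous fun t => (1 / 2) * (deriv r t) ^ 2 + c ^ 2 / 2 * (1 - r t ^ 2) ^ 2 := by
    intro r hr
    have := hr.continuous
    have := hr.continuous_deriv le_rfl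
    fun_prop
  apply le_antisymm
  · obtain ⟨r, hr, hlim, h0, hode⟩ := exists_optimal_profile hc hρ
    refine (iInf_le _ ⟨r, hr, hlim, h0⟩).trans (le_of_eq ?_)
    dsimp only
    rw [← h0]
    refine lintegral_Iic_of_hasDerivAt_of_nonneg (g := fun t => F (r t)) (fun t ht => ?_)
      (hFlim hlim) (hL hr) fun t => by positivity
    refine (hFderiv (hode t ht)).congr_deriv ?_
    rw [(hode t ht).deriv]
    ring
  · refine le_iInf fun ⟨r, hr, hlim, h0⟩ => ?_
    have hcont := hr.continuous
    have hcont' := hr.continuous_deriv le_rfl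
    dsimp only
    rw [← h0]
    refine ofReal_sub_le_lintegral_Iic (g := fun t => F (r t))
      (fun t => hFderiv (hr.differentiable one_ne_zero t).hasDerivAt) (by fun_prop)
      (hFlim hlim) (hL hr) (fun t => by positivity) fun t => ?_
    nlinarith [sq_nonneg (deriv r t + c * (1 - r t ^ 2))]
end

section
/- Let ẽ > 0 and θ_x ∈ [0, π/2]. The infimum, over all continuously differentiable θ : ℝ → ℝ with θ(t) → 0 as t → −∞ and θ(0) = θ_x, of ∫_{−∞}^0 ( ½ θ'(t)² + (1/(2ẽ²)) sin²(θ(t)) cos²(θ(t)) ) dt equals sin²(θ_x) / (2ẽ). -/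
open Filter MeasureTheory
open scoped ENNReal

/-- A nonnegative function that dominates the derivative of `G`, where `G → 0` at `-∞`, has
integral at least `G a` over `(-∞, a]`. -/
lemma ofReal_le_setLIntegral_Iic_of_hasDerivAt {G G' F : ℝ → ℝ} {a : ℝ}
    (hG : ∀ t, HasDerivAt G (G' t) t) (hG' : Continuous G') (hF : Continuous F)
    (hF0 : ∀ t, 0 ≤ F t) (hle : ∀ t, G' t ≤ F t) (hlim : Tendsto G atBot (nhds 0)) :
    ENNReal.ofReal (G a) ≤ ∫⁻ t in Set.Iic a, ENNReal.ofReal (F t) := by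
  have hbound : ∀ᶠ T in atBot,
      ENNReal.ofReal (G a - G T) ≤ ∫⁻ t in Set.Iic a, ENNReal.ofReal (F t) := by
    filter_upwards [eventually_le_atBot a] with T hT
    calc ENNReal.ofReal (G a - G T)
        = ENNReal.ofReal (∫ t in T..a, G' t) := by
          rw [intervalIntegral.integral_eq_sub_of_hasDerivAt (fun t _ => hG t)
            (hG'.intervalIntegrable T a)]
      _ ≤ ENNReal.ofReal (∫ t in T..a, F t) := ENNReal.ofReal_le_ofReal
          (intervalIntegral.integral_mono hT (hG'.intervalIntegrable T a)
            (hF.intervalIntegrable T a) hle)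
      _ = ∫⁻ t in Set.Ioc T a, ENNReal.ofReal (F t) := by
          rw [intervalIntegral.integral_of_le hT]
          exact ofReal_integral_eq_lintegral_ofReal (hF.intervalIntegrable T a).1
            (Eventually.of_forall hF0)
      _ ≤ ∫⁻ t in Set.Iic a, ENNReal.ofReal (F t) :=
          lintegral_mono_set Set.Ioc_subset_Iic_self
  have hT : Tendsto (fun T => ENNReal.ofReal (G a - G T)) atBot
      (nhds (ENNReal.ofReal (G a))) := by
    have := ENNReal.tendsto_ofReal (hlim.const_sub (G a))
    rwa [sub_zero] at this
  exact le_of_tendsto hT hbound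

/-- The integral over `(-∞, a]` of a nonnegative derivative of a function vanishing at `-∞`. -/
lemma setLIntegral_Iic_of_hasDerivAt_of_nonneg {G G' : ℝ → ℝ} {a : ℝ}
    (hG : ∀ t, HasDerivAt G (G' t) t) (hG' : Continuous G') (hpos : ∀ t ≤ a, 0 ≤ G' t)
    (hlim : Tendsto G atBot (nhds 0)) :
    ∫⁻ t in Set.Iic a, ENNReal.ofReal (G' t) = ENNReal.ofReal (G a) := by
  have hint : IntegrableOn G' (Set.Iic a) := by
    refine integrableOn_Iic_of_intervalIntegral_norm_tendsto (G a - 0) a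
      (fun T => (hG'.intervalIntegrable T a).1) tendsto_id ((hlim.const_sub (G a)).congr' ?_)
    filter_upwards [eventually_le_atBot a] with T hT
    rw [← intervalIntegral.integral_eq_sub_of_hasDerivAt (fun t _ => hG t)
      (hG'.intervalIntegrable T a)]
    refine intervalIntegral.integral_congr fun t ht => ?_
    rw [Set.uIcc_of_le hT] at ht
    exact (Real.norm_of_nonneg (hpos t ht.2)).symm
  rw [← ofReal_integral_eq_lintegral_ofReal hint
    ((ae_restrict_iff' measurableSet_Iic).2 (Eventually.of_forall hpos)),
    integral_Iic_of_hasDerivAt_of_tendsto' (fun t _ => hG t) hint hlim, sub_zero]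

lemma hasDerivAt_sin_sq_div {θ : ℝ → ℝ} {θ' t : ℝ} (et : ℝ) (h : HasDerivAt θ θ' t) :
    HasDerivAt (fun s => Real.sin (θ s) ^ 2 / (2 * et))
      (Real.sin (θ t) * Real.cos (θ t) / et * θ') t := by
  refine ((h.sin.pow 2).div_const (2 * et)).congr_deriv ?_
  push_cast
  ring

lemma tendsto_sin_sq_div {θ : ℝ → ℝ} {l : Filter ℝ} (et : ℝ) (h : Tendsto θ l (nhds 0)) :
    Tendsto (fun s => Real.sin (θ s) ^ 2 / (2 * et)) l (nhds 0) := by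
  have := (((Real.continuous_sin.tendsto 0).comp h).pow 2).div_const (2 * et)
  simpa using this

lemma ofReal_sin_sq_div_le_action {et : ℝ} {θ : ℝ → ℝ} (hθ : ContDiff ℝ 1 θ)
    (hlim : Tendsto θ atBot (nhds 0)) :
    ENNReal.ofReal (Real.sin (θ 0) ^ 2 / (2 * et)) ≤
      ∫⁻ t in Set.Iic (0 : ℝ), ENNReal.ofReal ((1 / 2) * (deriv θ t) ^ 2
        + (1 / (2 * et ^ 2)) * Real.sin (θ t) ^ 2 * Real.cos (θ t) ^ 2) := by
  have hd : Continuous (deriv θ) := hθ.continuous_deriv le_rfl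
  have hc : Continuous θ := hθ.continuous
  refine ofReal_le_setLIntegral_Iic_of_hasDerivAt
    (fun t => hasDerivAt_sin_sq_div et ((hθ.differentiable one_ne_zero) t).hasDerivAt)
    (by fun_prop) (by fun_prop) (fun t => by positivity) (fun t => ?_)
    (tendsto_sin_sq_div et hlim)
  have h := sq_nonneg (deriv θ t - Real.sin (θ t) * Real.cos (θ t) / et)
  have e : (1 / (2 * et ^ 2)) * Real.sin (θ t) ^ 2 * Real.cos (θ t) ^ 2
      = (1 / 2) * (Real.sin (θ t) * Real.cos (θ t) / et) ^ 2 := by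
    rw [div_pow, mul_pow, one_div, mul_inv]
    ring
  rw [e]
  linarith

/-- The trajectory through `arccot z₀` at time `0` that solves
`θ' = (sin θ cos θ + δ sin² θ) / et`. -/
noncomputable def arccotTrajectory (et z₀ δ t : ℝ) : ℝ :=
  Real.pi / 2 - Real.arctan ((z₀ + δ) * Real.exp (-t / et) - δ)

lemma arccotTrajectory_zero (et z₀ δ : ℝ) :
    arccotTrajectory et z₀ δ 0 = Real.pi / 2 - Real.arctan z₀ := by
  simp [arccotTrajectory]

lemma contDiff_arccotTrajectory (et z₀ δ : ℝ) : ContDiff ℝ 1 (arccotTrajectory et z₀ δ) := by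
  unfold arccotTrajectory
  exact contDiff_const.sub (Real.contDiff_arctan.comp (by fun_prop))

lemma tendsto_arccotTrajectory {et z₀ δ : ℝ} (het : 0 < et) (h : 0 < z₀ + δ) :
    Tendsto (arccotTrajectory et z₀ δ) atBot (nhds 0) := by
  have h1 : Tendsto (fun t : ℝ => -t / et) atBot atTop :=
    tendsto_neg_atBot_atTop.atTop_div_const het
  have h2 : Tendsto (fun t : ℝ => (z₀ + δ) * Real.exp (-t / et) - δ) atBot atTop :=
    tendsto_atTop_add_const_right _ (-δ) ((Real.tendsto_exp_atTop.comp h1).const_mul_atTop h)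
  have h3 := ((Real.tendsto_arctan_atTop.mono_right nhdsWithin_le_nhds).comp h2).const_sub
    (Real.pi / 2)
  rwa [sub_self] at h3

lemma hasDerivAt_arccotTrajectory (et z₀ δ t : ℝ) :
    HasDerivAt (arccotTrajectory et z₀ δ)
      ((Real.sin (arccotTrajectory et z₀ δ t) * Real.cos (arccotTrajectory et z₀ δ t)
        + δ * Real.sin (arccotTrajectory et z₀ δ t) ^ 2) / et) t := by
  have h1 : HasDerivAt (fun s : ℝ => (z₀ + δ) * Real.exp (-s / et) - δ)
      ((z₀ + δ) * (Real.exp (-t / et) * (-1 / et))) t :=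
    ((((hasDerivAt_id t).neg.div_const et).exp).const_mul (z₀ + δ)).sub_const δ
  refine (h1.arctan.const_sub (Real.pi / 2)).congr_deriv ?_
  symm
  simp only [arccotTrajectory, Real.sin_pi_div_two_sub, Real.cos_pi_div_two_sub]
  set z := (z₀ + δ) * Real.exp (-t / et) - δ with hz
  have hsin : Real.cos (Real.arctan z) * Real.sin (Real.arctan z) = z * (1 / (1 + z ^ 2)) := by
    have htan := Real.tan_mul_cos (Real.cos_arctan_pos z).ne'
    rw [Real.tan_arctan] at htan
    rw [← Real.cos_sq_arctan, ← htan]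
    ring
  rw [hsin, Real.cos_sq_arctan]
  have hexp : (z₀ + δ) * Real.exp (-t / et) = z + δ := by rw [hz]; ring
  linear_combination (-(1 / (1 + z ^ 2)) / et) * hexp

lemma sin_mul_cos_arccotTrajectory_nonneg {et z₀ δ t : ℝ} (het : 0 < et) (hz : 0 ≤ z₀)
    (hδ : 0 ≤ δ) (ht : t ≤ 0) :
    0 ≤ Real.sin (arccotTrajectory et z₀ δ t) * Real.cos (arccotTrajectory et z₀ δ t) := by
  simp only [arccotTrajectory, Real.sin_pi_div_two_sub, Real.cos_pi_div_two_sub]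
  refine mul_nonneg (Real.cos_arctan_pos _).le (Real.sin_arctan_nonneg.2 ?_)
  have h1 : 1 ≤ Real.exp (-t / et) :=
    Real.one_le_exp (div_nonneg (neg_nonneg.2 ht) het.le)
  nlinarith [mul_nonneg (add_nonneg hz hδ) (sub_nonneg.2 h1)]

lemma action_arccotTrajectory_le {et z₀ δ : ℝ} (het : 0 < et) (hz : 0 ≤ z₀) (hδ : 0 < δ) :
    ∫⁻ t in Set.Iic (0 : ℝ), ENNReal.ofReal ((1 / 2) * (deriv (arccotTrajectory et z₀ δ) t) ^ 2
        + (1 / (2 * et ^ 2)) * Real.sin (arccotTrajectory et z₀ δ t) ^ 2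
          * Real.cos (arccotTrajectory et z₀ δ t) ^ 2) ≤
      ENNReal.ofReal (Real.sin (arccotTrajectory et z₀ δ 0) ^ 2 / (2 * et)
        + δ / (2 * et) * arccotTrajectory et z₀ δ 0) := by
  set θ := arccotTrajectory et z₀ δ with hθ
  have hd : ∀ t, HasDerivAt θ ((Real.sin (θ t) * Real.cos (θ t) + δ * Real.sin (θ t) ^ 2) / et) t :=
    hasDerivAt_arccotTrajectory et z₀ δ
  have hlim : Tendsto θ atBot (nhds 0) := tendsto_arccotTrajectory het (by linarith)
  have hc : Continuous θ := (contDiff_arccotTrajectory et z₀ δ).continuous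
  have hsc : ∀ t ≤ 0, 0 ≤ Real.sin (θ t) * Real.cos (θ t) := fun t ht =>
    sin_mul_cos_arccotTrajectory_nonneg het hz hδ.le ht
  have hlimG := (tendsto_sin_sq_div et hlim).add (hlim.const_mul (δ / (2 * et)))
  rw [mul_zero, add_zero] at hlimG
  rw [← setLIntegral_Iic_of_hasDerivAt_of_nonneg
    (G := fun t => Real.sin (θ t) ^ 2 / (2 * et) + δ / (2 * et) * θ t)
    (fun t => (hasDerivAt_sin_sq_div et (hd t)).add ((hd t).const_mul (δ / (2 * et))))
    (by fun_prop) (fun t ht => ?_) hlimG]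
  · refine setLIntegral_mono' measurableSet_Iic fun t ht => ENNReal.ofReal_le_ofReal ?_
    rw [(hd t).deriv]
    rw [← sub_nonneg]
    have e : Real.sin (θ t) * Real.cos (θ t) / et *
          ((Real.sin (θ t) * Real.cos (θ t) + δ * Real.sin (θ t) ^ 2) / et)
        + δ / (2 * et) * ((Real.sin (θ t) * Real.cos (θ t) + δ * Real.sin (θ t) ^ 2) / et)
        - ((1 / 2) * ((Real.sin (θ t) * Real.cos (θ t) + δ * Real.sin (θ t) ^ 2) / et) ^ 2
          + (1 / (2 * et ^ 2)) * Real.sin (θ t) ^ 2 * Real.cos (θ t) ^ 2)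
        = δ * (Real.sin (θ t) * Real.cos (θ t)
            + δ * Real.sin (θ t) ^ 2 * Real.cos (θ t) ^ 2) / (2 * et ^ 2) := by
      have hs : Real.cos (θ t) ^ 2 = 1 - Real.sin (θ t) ^ 2 := Real.cos_sq' _
      linear_combination (-(δ ^ 2 * Real.sin (θ t) ^ 2) / (2 * et ^ 2)) * hs
    rw [e]
    have := hsc t ht
    positivity
  · have := hsc t ht
    positivity

lemma iInf_action_le {et θx : ℝ} (het : 0 < et) (hθx : θx ∈ Set.Icc 0 (Real.pi / 2)) :
    (⨅ θ : {θ : ℝ → ℝ // ContDiff ℝ 1 θ ∧ Tendsto θ atBot (nhds 0) ∧ θ 0 = θx},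
      ∫⁻ t in Set.Iic (0 : ℝ),
        ENNReal.ofReal ((1 / 2) * (deriv θ.1 t) ^ 2
          + (1 / (2 * et ^ 2)) * Real.sin (θ.1 t) ^ 2 * Real.cos (θ.1 t) ^ 2))
    ≤ ENNReal.ofReal (Real.sin θx ^ 2 / (2 * et)) := by
  rcases hθx.1.eq_or_lt with rfl | hpos
  · exact (iInf_le _ ⟨fun _ => 0, contDiff_const, tendsto_const_nhds, rfl⟩).trans (by simp)
  have hz : 0 ≤ Real.tan (Real.pi / 2 - θx) :=
    Real.tan_nonneg_of_nonneg_of_le_pi_div_two (by linarith [hθx.2]) (by linarith)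
  have h0 : ∀ δ, arccotTrajectory et (Real.tan (Real.pi / 2 - θx)) δ 0 = θx := fun δ => by
    rw [arccotTrajectory_zero, Real.arctan_tan (by linarith [hθx.2, Real.pi_pos]) (by linarith)]
    ring
  have hlim : Tendsto (fun δ => ENNReal.ofReal (Real.sin θx ^ 2 / (2 * et) + δ / (2 * et) * θx))
      (nhdsWithin 0 (Set.Ioi 0)) (nhds (ENNReal.ofReal (Real.sin θx ^ 2 / (2 * et)))) := by
    have hc : Continuous fun δ : ℝ => Real.sin θx ^ 2 / (2 * et) + δ / (2 * et) * θx := by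
      fun_prop
    have := (ENNReal.continuous_ofReal.comp hc).tendsto 0
    simp only [Function.comp_def, zero_div, zero_mul, add_zero] at this
    exact this.mono_left nhdsWithin_le_nhds
  refine ge_of_tendsto hlim ?_
  filter_upwards [self_mem_nhdsWithin] with δ (hδ : 0 < δ)
  refine (iInf_le _ ⟨arccotTrajectory et (Real.tan (Real.pi / 2 - θx)) δ,
    contDiff_arccotTrajectory _ _ _, tendsto_arccotTrajectory het (by linarith), h0 δ⟩).trans ?_
  simpa only [h0] using action_arccotTrajectory_le het hz hδ

/-- The half-line action for the angular potential `(1/(2ẽ²)) sin²θ cos²θ`, connecting the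
value `0` at `-∞` to the value `θ_x` at time `0`, equals `sin²θ_x/(2ẽ)`. -/
theorem angular_action_value (et θx : ℝ) (het : 0 < et)
    (hθx : θx ∈ Set.Icc 0 (Real.pi / 2)) :
    (⨅ θ : {θ : ℝ → ℝ // ContDiff ℝ 1 θ ∧ Tendsto θ atBot (nhds 0) ∧ θ 0 = θx},
      ∫⁻ t in Set.Iic (0 : ℝ),
        ENNReal.ofReal ((1 / 2) * (deriv θ.1 t) ^ 2
          + (1 / (2 * et ^ 2)) * Real.sin (θ.1 t) ^ 2 * Real.cos (θ.1 t) ^ 2))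
    = ENNReal.ofReal (Real.sin θx ^ 2 / (2 * et)) := by
  refine le_antisymm (iInf_action_le het hθx) (le_iInf fun ⟨θ, hθ, hlim, h0⟩ => ?_)
  simpa only [h0] using ofReal_sin_sq_div_le_action (et := et) hθ hlim
end

section
/- Let ε > 0 and ẽ > 0, and define W : ℝ² → ℝ by W(p₁, p₂) = (1 − p₁² − p₂²)²/(4ε²) + (1/(2ẽ²)) p₁² p₂². Then the heteroclinic action m := inf { ∫_{−∞}^{+∞} ( ½‖γ'(t)‖² + W(γ(t)) ) dt : γ : ℝ → ℝ² continuously differentiable, γ(t) → (0,1) as t → −∞, γ(t) → (1,0) as t → +∞ } satisfies m ≤ 1/(2ẽ). -/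
open Filter MeasureTheory
open scoped ENNReal

open Topology in
/-- The integral over the line of a continuous nonnegative derivative is the difference of the
limits of the primitive at the two ends. -/
lemma lintegral_ofReal_eq_sub_of_hasDerivAt_of_tendsto {F f : ℝ → ℝ} {a b : ℝ}
    (hF : ∀ t, HasDerivAt F (f t) t) (hf : Continuous f) (hf0 : ∀ t, 0 ≤ f t)
    (hbot : Tendsto F atBot (𝓝 a)) (htop : Tendsto F atTop (𝓝 b)) :
    ∫⁻ t, ENNReal.ofReal (f t) = ENNReal.ofReal (b - a) := by
  have hint : Integrable f := by
    refine integrable_of_intervalIntegral_norm_tendsto (l := atTop) (a := fun i : ℝ => -i)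
      (b := fun i => i) (b - a) (fun i => hf.integrableOn_Ioc) tendsto_neg_atTop_atBot
      tendsto_id ?_
    have hval : ∀ i : ℝ, ∫ x in (-i)..i, ‖f x‖ = F i - F (-i) := fun i => by
      simp_rw [Real.norm_of_nonneg (hf0 _)]
      exact intervalIntegral.integral_eq_sub_of_hasDerivAt (fun x _ => hF x)
        (hf.intervalIntegrable _ _)
    simp_rw [hval]
    exact htop.sub (hbot.comp tendsto_neg_atTop_atBot)
  rw [← ofReal_integral_eq_lintegral_ofReal hint (Eventually.of_forall hf0),
    integral_of_hasDerivAt_of_tendsto hF hint hbot htop]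

/-- The angle `arctan (exp (t / c))`, whose sine and cosine trace the quarter circle between the
two wells. -/
noncomputable def profileAngle (c t : ℝ) : ℝ := Real.arctan (Real.exp (t / c))

lemma contDiff_profileAngle (c : ℝ) : ContDiff ℝ 1 (profileAngle c) :=
  (Real.contDiff_exp.comp (contDiff_id.div_const c)).arctan

lemma hasDerivAt_profileAngle (c t : ℝ) :
    HasDerivAt (profileAngle c)
      (Real.sin (profileAngle c t) * Real.cos (profileAngle c t) / c) t := by
  have hsin : Real.sin (profileAngle c t) = Real.exp (t / c) * Real.cos (profileAngle c t) := by
    rw [profileAngle, ← Real.tan_mul_cos (Real.cos_arctan_pos _).ne', Real.tan_arctan]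
  have hcos : Real.cos (profileAngle c t) ^ 2 = 1 / (1 + Real.exp (t / c) ^ 2) :=
    Real.cos_sq_arctan _
  refine ((hasDerivAt_id t).div_const c).exp.arctan.congr_deriv ?_
  rw [hsin, mul_assoc, ← pow_two, hcos]
  simp only [id]
  ring

lemma tendsto_profileAngle_atBot {c : ℝ} (hc : 0 < c) :
    Tendsto (profileAngle c) atBot (nhds 0) := by
  have h := Real.tendsto_exp_atBot.comp (tendsto_id.atBot_div_const hc)
  rw [← Real.arctan_zero]
  exact (Real.continuous_arctan.tendsto 0).comp h

lemma tendsto_profileAngle_atTop {c : ℝ} (hc : 0 < c) :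
    Tendsto (profileAngle c) atTop (nhds (Real.pi / 2)) :=
  (tendsto_nhds_of_tendsto_nhdsWithin Real.tendsto_arctan_atTop).comp
    (Real.tendsto_exp_atTop.comp (tendsto_id.atTop_div_const hc))

/-- The heteroclinic action between the wells `(0,1)` and `(1,0)` of the two-component
Gross–Pitaevskii potential `W(p₁,p₂) = (1-p₁²-p₂²)²/(4ε²) + p₁²p₂²/(2ẽ²)` is at most
`1/(2ẽ)`. -/
theorem heteroclinic_action_upper_bound (ε et : ℝ) (hε : 0 < ε) (het : 0 < et) :
    (⨅ γ : {γ : ℝ → ℝ × ℝ // ContDiff ℝ 1 γ ∧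
        Tendsto γ atBot (nhds ((0 : ℝ), (1 : ℝ))) ∧
        Tendsto γ atTop (nhds ((1 : ℝ), (0 : ℝ)))},
      ∫⁻ t : ℝ, ENNReal.ofReal
        ((1 / 2) * ((deriv (fun s => (γ.1 s).1) t) ^ 2 + (deriv (fun s => (γ.1 s).2) t) ^ 2)
          + (1 - (γ.1 t).1 ^ 2 - (γ.1 t).2 ^ 2) ^ 2 / (4 * ε ^ 2)
          + (1 / (2 * et ^ 2)) * ((γ.1 t).1 ^ 2 * (γ.1 t).2 ^ 2)))
    ≤ ENNReal.ofReal (1 / (2 * et)) := by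
  set θ := profileAngle et
  have hθ : ∀ t, HasDerivAt θ (Real.sin (θ t) * Real.cos (θ t) / et) t :=
    hasDerivAt_profileAngle et
  have hθbot : Tendsto θ atBot (nhds 0) := tendsto_profileAngle_atBot het
  have hθtop : Tendsto θ atTop (nhds (Real.pi / 2)) := tendsto_profileAngle_atTop het
  have hθc : ContDiff ℝ 1 θ := contDiff_profileAngle et
  have hbot : Tendsto (fun t => (Real.sin (θ t), Real.cos (θ t))) atBot (nhds (0, 1)) := by
    simpa using ((Real.continuous_sin.tendsto _).comp hθbot).prodMk_nhds
      ((Real.continuous_cos.tendsto _).comp hθbot)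
  have htop : Tendsto (fun t => (Real.sin (θ t), Real.cos (θ t))) atTop (nhds (1, 0)) := by
    simpa using ((Real.continuous_sin.tendsto _).comp hθtop).prodMk_nhds
      ((Real.continuous_cos.tendsto _).comp hθtop)
  refine (iInf_le _ ⟨_, hθc.sin.prodMk hθc.cos, hbot, htop⟩).trans (le_of_eq ?_)
  have hsinbot : Tendsto (fun t => Real.sin (θ t) ^ 2 / (2 * et)) atBot (nhds 0) := by
    simpa using (((Real.continuous_sin.tendsto _).comp hθbot).pow 2).div_const (2 * et)
  have hsintop : Tendsto (fun t => Real.sin (θ t) ^ 2 / (2 * et)) atTop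
      (nhds (1 / (2 * et))) := by
    simpa using (((Real.continuous_sin.tendsto _).comp hθtop).pow 2).div_const (2 * et)
  have key := lintegral_ofReal_eq_sub_of_hasDerivAt_of_tendsto
    (f := fun t => (Real.sin (θ t) * Real.cos (θ t) / et) ^ 2) (fun t => by
      refine (((hθ t).sin.pow 2).div_const (2 * et)).congr_deriv ?_
      field_simp
      push_cast
      ring)
    (by have := hθc.continuous; fun_prop) (fun t => sq_nonneg _) hsinbot hsintop
  rw [sub_zero] at key
  rw [← key]
  refine lintegral_congr fun t => congrArg ENNReal.ofReal ?_
  simp only [(hθ t).sin.deriv, (hθ t).cos.deriv]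
  have hcirc : Real.cos (θ t) ^ 2 = 1 - Real.sin (θ t) ^ 2 := Real.cos_sq' _
  rw [sub_sub, Real.sin_sq_add_cos_sq, sub_self]
  simp only [mul_pow, div_pow, neg_sq, hcirc]
  ring
end

section
/- Let β > 0 and let ω ⊂ ℝ² be a bounded open set. Let h : ℝ² → ℝ be continuously differentiable with compact support contained in ω and with |h(x)| ≤ 1/(2β) for all x. Then sup over all twice continuously differentiable k : ℝ² → ℝ of the quantity ∫_ω ∇h(x)·∇k(x) dx − (1/(2β)) ∫_ω |Δk(x) + 2| dx equals 2 ∫_ω h(x) dx, and the supremum is attained at k(x) = −‖x‖²/2. -/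
open MeasureTheory

noncomputable section

/-- Laplacian of a real-valued function on `ℝ²`. -/
def lapR (k : ℝ × ℝ → ℝ) (x : ℝ × ℝ) : ℝ :=
  fderiv ℝ (fun y => fderiv ℝ k y (1, 0)) x (1, 0) +
  fderiv ℝ (fun y => fderiv ℝ k y (0, 1)) x (0, 1)

/-- The dual functional `k ↦ ∫_ω ∇h·∇k - (1/(2β)) ∫_ω |Δk + 2|`. -/
def dualFunctional (β : ℝ) (ω : Set (ℝ × ℝ)) (h k : ℝ × ℝ → ℝ) : ℝ :=
  (∫ x in ω, (fderiv ℝ h x (1, 0) * fderiv ℝ k x (1, 0)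
      + fderiv ℝ h x (0, 1) * fderiv ℝ k x (0, 1)))
    - (1 / (2 * β)) * ∫ x in ω, |lapR k x + 2|

/-- The gradient pairing `∇h·∇k` on `ℝ²`. -/
def gradPairing (h k : ℝ × ℝ → ℝ) (x : ℝ × ℝ) : ℝ :=
  fderiv ℝ h x (1, 0) * fderiv ℝ k x (1, 0) + fderiv ℝ h x (0, 1) * fderiv ℝ k x (0, 1)

theorem contDiff_fderiv_apply_const {k : ℝ × ℝ → ℝ} (hk : ContDiff ℝ 2 k) (v : ℝ × ℝ) :
    ContDiff ℝ 1 (fun y => fderiv ℝ k y v) :=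
  (hk.fderiv_right (m := 1) (by norm_num)).clm_apply contDiff_const

theorem continuous_fderiv_apply_const {h : ℝ × ℝ → ℝ} (hh : ContDiff ℝ 1 h) (v : ℝ × ℝ) :
    Continuous (fun y => fderiv ℝ h y v) :=
  (hh.continuous_fderiv (by norm_num)).clm_apply continuous_const

theorem continuous_lapR {k : ℝ × ℝ → ℝ} (hk : ContDiff ℝ 2 k) : Continuous (lapR k) :=
  (continuous_fderiv_apply_const (contDiff_fderiv_apply_const hk _) _).add
    (continuous_fderiv_apply_const (contDiff_fderiv_apply_const hk _) _)

theorem hasCompactSupport_fderiv_apply {h : ℝ × ℝ → ℝ} (hsupp : HasCompactSupport h)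
    (v : ℝ × ℝ) : HasCompactSupport (fun y => fderiv ℝ h y v) :=
  hsupp.fderiv_apply (𝕜 := ℝ) v

theorem integrable_fderiv_mul_fderiv {h k : ℝ × ℝ → ℝ} (hh : ContDiff ℝ 1 h)
    (hsupp : HasCompactSupport h) (hk : ContDiff ℝ 2 k) (v : ℝ × ℝ) :
    Integrable (fun x => fderiv ℝ h x v * fderiv ℝ k x v) :=
  ((continuous_fderiv_apply_const hh v).mul
    (contDiff_fderiv_apply_const hk v).continuous).integrable_of_hasCompactSupport
      (hasCompactSupport_fderiv_apply hsupp v).mul_right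

theorem integrable_mul_fderiv_fderiv {h k : ℝ × ℝ → ℝ} (hh : ContDiff ℝ 1 h)
    (hsupp : HasCompactSupport h) (hk : ContDiff ℝ 2 k) (v : ℝ × ℝ) :
    Integrable (fun x => h x * fderiv ℝ (fun y => fderiv ℝ k y v) x v) :=
  (hh.continuous.mul (continuous_fderiv_apply_const
    (contDiff_fderiv_apply_const hk v) v)).integrable_of_hasCompactSupport hsupp.mul_right

theorem integral_fderiv_mul_fderiv {h k : ℝ × ℝ → ℝ} (hh : ContDiff ℝ 1 h)
    (hsupp : HasCompactSupport h) (hk : ContDiff ℝ 2 k) (v : ℝ × ℝ) :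
    ∫ x, fderiv ℝ h x v * fderiv ℝ k x v =
      -∫ x, h x * fderiv ℝ (fun y => fderiv ℝ k y v) x v := by
  have hkv := contDiff_fderiv_apply_const hk v
  rw [integral_mul_fderiv_eq_neg_fderiv_mul_of_integrable
    (integrable_fderiv_mul_fderiv hh hsupp hk v) (integrable_mul_fderiv_fderiv hh hsupp hk v)
    ((hh.continuous.mul hkv.continuous).integrable_of_hasCompactSupport hsupp.mul_right)
    (fun x _ => hh.differentiable (by norm_num) x)
    (fun x _ => hkv.differentiable (by norm_num) x), neg_neg]

/-- Green's identity on `ω` for `h` compactly supported in `ω`. -/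
theorem setIntegral_gradPairing {ω : Set (ℝ × ℝ)} {h k : ℝ × ℝ → ℝ} (hh : ContDiff ℝ 1 h)
    (hsupp : HasCompactSupport h) (hsub : tsupport h ⊆ ω) (hk : ContDiff ℝ 2 k) :
    ∫ x in ω, gradPairing h k x = -∫ x in ω, h x * lapR k x := by
  have hz : ∀ x, x ∉ ω → h x = 0 := fun x hx =>
    image_eq_zero_of_notMem_tsupport fun hx' => hx (hsub hx')
  have hz' : ∀ x, x ∉ ω → fderiv ℝ h x = 0 := fun x hx =>
    image_eq_zero_of_notMem_tsupport fun hx' => hx (hsub (tsupport_fderiv_subset ℝ hx'))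
  rw [setIntegral_eq_integral_of_forall_compl_eq_zero fun x hx => by
      simp [gradPairing, hz' x hx],
    setIntegral_eq_integral_of_forall_compl_eq_zero fun x hx => by simp [hz x hx]]
  simp only [gradPairing, lapR, mul_add]
  rw [integral_add (integrable_fderiv_mul_fderiv hh hsupp hk _)
      (integrable_fderiv_mul_fderiv hh hsupp hk _),
    integral_add (integrable_mul_fderiv_fderiv hh hsupp hk _)
      (integrable_mul_fderiv_fderiv hh hsupp hk _),
    integral_fderiv_mul_fderiv hh hsupp hk, integral_fderiv_mul_fderiv hh hsupp hk, neg_add]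

theorem dualFunctional_eq {β : ℝ} {ω : Set (ℝ × ℝ)} {h k : ℝ × ℝ → ℝ} (hh : ContDiff ℝ 1 h)
    (hsupp : HasCompactSupport h) (hsub : tsupport h ⊆ ω) (hk : ContDiff ℝ 2 k) :
    dualFunctional β ω h k = 2 * (∫ x in ω, h x) - (∫ x in ω, h x * (lapR k x + 2))
      - (1 / (2 * β)) * ∫ x in ω, |lapR k x + 2| := by
  have hint : Integrable (fun x => h x * lapR k x) (volume.restrict ω) :=
    ((hh.continuous.mul (continuous_lapR hk)).integrable_of_hasCompactSupport
      hsupp.mul_right).integrableOn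
  have hint' : Integrable h (volume.restrict ω) :=
    (hh.continuous.integrable_of_hasCompactSupport hsupp).integrableOn
  have hgreen := setIntegral_gradPairing hh hsupp hsub hk
  simp only [gradPairing] at hgreen
  simp only [mul_add]
  rw [dualFunctional, hgreen, integral_add hint (hint'.mul_const 2), integral_mul_const]
  ring

theorem integrableOn_of_isBounded {ω : Set (ℝ × ℝ)} (hωb : Bornology.IsBounded ω)
    {f : ℝ × ℝ → ℝ} (hf : Continuous f) : IntegrableOn f ω :=
  (hf.continuousOn.integrableOn_compact hωb.isCompact_closure).mono_set subset_closure

theorem lapR_neg_half_normSq (x : ℝ × ℝ) :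
    lapR (fun x => -(x.1 ^ 2 + x.2 ^ 2) / 2) x = -2 := by
  have hd : ∀ y : ℝ × ℝ, HasFDerivAt (fun x : ℝ × ℝ => -(x.1 ^ 2 + x.2 ^ 2) / 2)
      (-(y.1 • ContinuousLinearMap.fst ℝ ℝ ℝ + y.2 • ContinuousLinearMap.snd ℝ ℝ ℝ)) y := by
    intro y
    have h1 := ((hasFDerivAt_fst (𝕜 := ℝ) (p := y)).pow 2).add
      ((hasFDerivAt_snd (𝕜 := ℝ) (p := y)).pow 2)
    convert! h1.neg.mul_const (1 / 2 : ℝ) using 1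
    · ext z; simp; ring
    · ext <;> simp
  have h1 : fderiv ℝ (fun y : ℝ × ℝ => -y.1) x = -ContinuousLinearMap.fst ℝ ℝ ℝ :=
    hasFDerivAt_fst.neg.fderiv
  have h2 : fderiv ℝ (fun y : ℝ × ℝ => -y.2) x = -ContinuousLinearMap.snd ℝ ℝ ℝ :=
    hasFDerivAt_snd.neg.fderiv
  simp only [lapR, fun y => (hd y).fderiv]
  simp [h1, h2]
  norm_num

/-- Convex-dual computation: the supremum over `C²` functions `k` of
`∫_ω ∇h·∇k - (1/(2β))∫_ω |Δk+2|` equals `2∫_ω h`, attained at `k(x) = -‖x‖²/2`. -/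
theorem dual_functional_sup
    (β : ℝ) (hβ : 0 < β) (ω : Set (ℝ × ℝ)) (hω : IsOpen ω) (hωb : Bornology.IsBounded ω)
    (h : ℝ × ℝ → ℝ) (hh : ContDiff ℝ 1 h) (hsupp : HasCompactSupport h)
    (hsub : tsupport h ⊆ ω) (hbound : ∀ x, |h x| ≤ 1 / (2 * β)) :
    (∀ k : ℝ × ℝ → ℝ, ContDiff ℝ 2 k →
        dualFunctional β ω h k ≤ 2 * ∫ x in ω, h x) ∧
    dualFunctional β ω h (fun x => -(x.1 ^ 2 + x.2 ^ 2) / 2) = 2 * ∫ x in ω, h x := by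
  refine ⟨fun k hk => ?_, ?_⟩
  · have hlap : Continuous fun x => lapR k x + 2 := (continuous_lapR hk).add continuous_const
    have hmono : ∫ x in ω, -(h x * (lapR k x + 2)) ≤
        ∫ x in ω, (1 / (2 * β)) * |lapR k x + 2| := by
      refine integral_mono (integrableOn_of_isBounded hωb (hh.continuous.mul hlap).neg)
        (integrableOn_of_isBounded hωb (hlap.abs.const_mul _)) fun x => ?_
      exact (neg_le_abs _).trans
        ((abs_mul _ _).trans_le (mul_le_mul_of_nonneg_right (hbound x) (abs_nonneg _)))
    rw [integral_neg, integral_const_mul] at hmono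
    rw [dualFunctional_eq hh hsupp hsub hk]
    linarith
  · rw [dualFunctional_eq hh hsupp hsub (by fun_prop)]
    simp only [lapR_neg_half_normSq]
    simp

end
end
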